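/- With c_back^{(M)} := sup_{t ∈ 𝒯_M} sSup σ(B^{(M)}_t) and c_over^{(M)} := inf_{t ∈ 𝒯_M} sInf σ(B^{(M)}_t), one has liminf_{M→∞} M^{−1/4}·c_back^{(M)} > 0 and limsup_{M→∞} M^{−1/4}·c_over^{(M)} < 0; in particular c_back^{(M)} → +∞ and c_over^{(M)} → −∞ as M → ∞. -/

import Mathlib

open MeasureTheory Filter

noncomputable section

namespace QB

/-- Lebesgue measure on the positive half-line. -/
abbrev μp : Measure ℝ := volume.restrict (Set.Ioi (0:ℝ))

/-- The Hilbert space `L²((0,∞))`. -/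
abbrev Hp : Type := Lp ℂ 2 μp

/-- The Hilbert space `L²(ℝ)`. -/
abbrev HL : Type := Lp ℂ 2 (volume : Measure ℝ)

/-- The defining properties of the operators: `S t` is multiplication by `e^{-i k² t}`,
`R` is the isometry "extend by zero and apply the inverse Fourier–Plancherel transform"
(characterised by its isometry property together with the integral formula on
integrable elements of `L²((0,∞))`, which determine it uniquely by continuity and density),
and `Pm` is the orthogonal projection onto functions supported in `(-∞,0)`. -/
structure Setup (S : ℝ → Hp →L[ℂ] Hp) (R : Hp →L[ℂ] HL) (Pm : HL →L[ℂ] HL) : Prop where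
  hS : ∀ (t : ℝ) (φ : Hp),
    (S t φ : ℝ → ℂ) =ᵐ[μp] fun k => Complex.exp (-Complex.I * (k:ℂ)^2 * (t:ℂ)) * φ k
  hR_isometry : ∀ φ : Hp, ‖R φ‖ = ‖φ‖
  hR : ∀ φ : Hp, Integrable (φ : ℝ → ℂ) μp →
    (R φ : ℝ → ℂ) =ᵐ[volume]
      fun x => (((2 * Real.pi) ^ (-(1/2) : ℝ) : ℝ) : ℂ) *
        ∫ k in Set.Ioi (0:ℝ), Complex.exp (Complex.I * (x:ℂ) * (k:ℂ)) * φ k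
  hPm : ∀ ψ : HL, (Pm ψ : ℝ → ℂ) =ᵐ[volume] Set.indicator (Set.Iio (0:ℝ)) (fun x => ψ x)

/-- The single backflow operator `B_{⟨t₁,t₂⟩} = S_{t₂}* R* Π⁻ R S_{t₂} − S_{t₁}* R* Π⁻ R S_{t₁}`. -/
def B1 (S : ℝ → Hp →L[ℂ] Hp) (R : Hp →L[ℂ] HL) (Pm : HL →L[ℂ] HL) (t₁ t₂ : ℝ) :
    Hp →L[ℂ] Hp :=
  (ContinuousLinearMap.adjoint (S t₂)).comp ((ContinuousLinearMap.adjoint R).comp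
    (Pm.comp (R.comp (S t₂))))
  - (ContinuousLinearMap.adjoint (S t₁)).comp ((ContinuousLinearMap.adjoint R).comp
    (Pm.comp (R.comp (S t₁))))

/-- The `M`-fold backflow operator `B^{(M)}_t = Σ_{j=1}^M B_{⟨t_{2j-1}, t_{2j}⟩}`
(zero-based indexing of the tuple `t`). -/
def BM (S : ℝ → Hp →L[ℂ] Hp) (R : Hp →L[ℂ] HL) (Pm : HL →L[ℂ] HL) (M : ℕ)
    (t : Fin (2*M) → ℝ) : Hp →L[ℂ] Hp :=
  ∑ j : Fin M, B1 S R Pm (t ⟨2*j.1, by have := j.isLt; omega⟩)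
    (t ⟨2*j.1+1, by have := j.isLt; omega⟩)

/-- `𝒯_M`: the set of strictly increasing `2M`-tuples of reals. -/
def TM (M : ℕ) : Set (Fin (2*M) → ℝ) := {t | StrictMono t}

/-- The `M`-th backflow constant `c_back^{(M)} = sup_{t ∈ 𝒯_M} sSup σ(B^{(M)}_t)`. -/
def cback (S : ℝ → Hp →L[ℂ] Hp) (R : Hp →L[ℂ] HL) (Pm : HL →L[ℂ] HL) (M : ℕ) : ℝ :=
  sSup ((fun t => sSup (spectrum ℝ (BM S R Pm M t))) '' TM M)

/-- The `M`-th overflow constant `c_over^{(M)} = inf_{t ∈ 𝒯_M} sInf σ(B^{(M)}_t)`. -/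
def cover (S : ℝ → Hp →L[ℂ] Hp) (R : Hp →L[ℂ] HL) (Pm : HL →L[ℂ] HL) (M : ℕ) : ℝ :=
  sInf ((fun t => sInf (spectrum ℝ (BM S R Pm M t))) '' TM M)

lemma sInf_spectrum_eq {A : Type*} [Ring A] [Algebra ℝ A] (a : A) :
    sInf (spectrum ℝ a) = -sSup (spectrum ℝ (-a)) := by
  rw [← spectrum.neg_eq, Real.sInf_def]

section Spectral
variable {E : Type*} [NormedAddCommGroup E] [InnerProductSpace ℂ E] [CompleteSpace E]

lemma forall_mem_spectrum_le_iff {B : E →L[ℂ] E} (hB : IsSelfAdjoint B) (C : ℝ) :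
    (∀ x ∈ spectrum ℝ B, x ≤ C) ↔ ∀ φ, (inner ℂ φ (B φ)).re ≤ C * ‖φ‖ ^ 2 := by
  rw [← le_algebraMap_iff_spectrum_le hB, ContinuousLinearMap.le_def,
    ContinuousLinearMap.isPositive_iff_complex]
  have hsa : IsSelfAdjoint (algebraMap ℝ (E →L[ℂ] E) C - B) :=
    (IsSelfAdjoint.algebraMap _ (.all C)).sub hB
  have key : ∀ φ, inner ℂ ((algebraMap ℝ (E →L[ℂ] E) C - B) φ) φ
      = (C * ‖φ‖ ^ 2 : ℝ) - inner ℂ φ (B φ) := by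
    intro φ
    have h1 : inner ℂ (B φ) φ = inner ℂ φ (B φ) := hB.isSymmetric φ φ
    have h2 : (algebraMap ℝ (E →L[ℂ] E) C) φ = (C : ℂ) • φ := by
      simp [Algebra.algebraMap_eq_smul_one]
    rw [sub_apply, inner_sub_left, h1, h2, inner_smul_left,
      inner_self_eq_norm_sq_to_K]
    simp
  constructor
  · intro h φ
    have := (h φ).2
    rw [key, RCLike.re_to_complex, Complex.sub_re, Complex.ofReal_re] at this
    linarith
  · intro h φ
    refine ⟨?_, ?_⟩
    · have := (hsa.isSymmetric.coe_re_inner_apply_self φ)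
      exact this
    · rw [key, RCLike.re_to_complex, Complex.sub_re, Complex.ofReal_re]
      linarith [h φ]

lemma sSup_spectrum_le [Nontrivial E] {B : E →L[ℂ] E} (hB : IsSelfAdjoint B) {C : ℝ}
    (h : ∀ φ, (inner ℂ φ (B φ)).re ≤ C * ‖φ‖ ^ 2) : sSup (spectrum ℝ B) ≤ C :=
  csSup_le (ContinuousFunctionalCalculus.spectrum_nonempty B hB)
    ((forall_mem_spectrum_le_iff hB C).2 h)

lemma re_inner_le_sSup_spectrum {B : E →L[ℂ] E} (hB : IsSelfAdjoint B) (φ : E) :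
    (inner ℂ φ (B φ)).re ≤ sSup (spectrum ℝ B) * ‖φ‖ ^ 2 :=
  (forall_mem_spectrum_le_iff hB _).1
    (fun _ hx => le_csSup (spectrum.isCompact B).bddAbove hx) φ

end Spectral

section Operators
variable {S : ℝ → Hp →L[ℂ] Hp} {R : Hp →L[ℂ] HL} {Pm : HL →L[ℂ] HL}

lemma Setup.norm_S (hs : Setup S R Pm) (t : ℝ) (φ : Hp) : ‖S t φ‖ = ‖φ‖ := by
  rw [Lp.norm_def, Lp.norm_def]
  congr 1
  apply eLpNorm_congr_norm_ae
  filter_upwards [hs.hS t φ] with k hk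
  rw [hk, norm_mul, show -Complex.I * (k : ℂ) ^ 2 * (t : ℂ) = ((-(k ^ 2 * t) : ℝ) : ℂ) * Complex.I by
    push_cast; ring, Complex.norm_exp_ofReal_mul_I, one_mul]

lemma Setup.norm_Pm_le (hs : Setup S R Pm) (ψ : HL) : ‖Pm ψ‖ ≤ ‖ψ‖ := by
  rw [Lp.norm_def, Lp.norm_def]
  refine ENNReal.toReal_mono (Lp.eLpNorm_ne_top ψ) ?_
  rw [eLpNorm_congr_ae (hs.hPm ψ)]
  exact eLpNorm_indicator_le _

lemma Setup.isSelfAdjoint_Pm (hs : Setup S R Pm) : IsSelfAdjoint Pm := by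
  rw [ContinuousLinearMap.isSelfAdjoint_iff_isSymmetric]
  intro f g
  rw [L2.inner_def, L2.inner_def]
  apply integral_congr_ae
  filter_upwards [hs.hPm f, hs.hPm g] with x hf hg
  simp only [ContinuousLinearMap.coe_coe, hf, hg]
  by_cases hx : x ∈ Set.Iio (0 : ℝ) <;> simp [hx]

/-- The inner product of `φ` with the operator `S_t* R* Π⁻ R S_t ψ`. -/
lemma inner_B1 (t₁ t₂ : ℝ) (φ ψ : Hp) :
    inner ℂ φ (B1 S R Pm t₁ t₂ ψ) = inner ℂ (R (S t₂ φ)) (Pm (R (S t₂ ψ)))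
      - inner ℂ (R (S t₁ φ)) (Pm (R (S t₁ ψ))) := by
  simp [B1, inner_sub_right, ContinuousLinearMap.adjoint_inner_right]

lemma Setup.isSelfAdjoint_B1 (hs : Setup S R Pm) (t₁ t₂ : ℝ) :
    IsSelfAdjoint (B1 S R Pm t₁ t₂) := by
  rw [ContinuousLinearMap.isSelfAdjoint_iff_isSymmetric]
  intro f g
  have hP := hs.isSelfAdjoint_Pm.isSymmetric
  have h : ∀ t, inner ℂ (Pm (R (S t f))) (R (S t g)) = inner ℂ (R (S t f)) (Pm (R (S t g))) :=
    fun t => hP _ _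
  rw [← inner_conj_symm]
  simp only [ContinuousLinearMap.coe_coe, inner_B1, map_sub, inner_conj_symm, h]

lemma Setup.isSelfAdjoint_BM (hs : Setup S R Pm) (M : ℕ) (t : Fin (2 * M) → ℝ) :
    IsSelfAdjoint (BM S R Pm M t) := by
  unfold BM
  exact isSelfAdjoint_sum _ fun j _ => hs.isSelfAdjoint_B1 _ _

lemma Setup.norm_inner_B1_le (hs : Setup S R Pm) (t₁ t₂ : ℝ) (φ : Hp) :
    ‖inner ℂ φ (B1 S R Pm t₁ t₂ φ)‖ ≤ 2 * ‖φ‖ ^ 2 := by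
  have h : ∀ t, ‖inner ℂ (R (S t φ)) (Pm (R (S t φ)))‖ ≤ ‖φ‖ ^ 2 := by
    intro t
    refine (norm_inner_le_norm _ _).trans ?_
    have h1 := hs.norm_Pm_le (R (S t φ))
    rw [hs.hR_isometry, hs.norm_S] at *
    nlinarith [norm_nonneg φ]
  rw [inner_B1]
  linarith [norm_sub_le (inner ℂ (R (S t₂ φ)) (Pm (R (S t₂ φ))))
    (inner ℂ (R (S t₁ φ)) (Pm (R (S t₁ φ)))), h t₁, h t₂]

lemma Setup.norm_inner_BM_le (hs : Setup S R Pm) (M : ℕ) (t : Fin (2 * M) → ℝ) (φ : Hp) :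
    ‖inner ℂ φ (BM S R Pm M t φ)‖ ≤ (2 * M) * ‖φ‖ ^ 2 := by
  rw [BM, sum_apply, inner_sum]
  refine (norm_sum_le _ _).trans ((Finset.sum_le_sum fun j _ => hs.norm_inner_B1_le _ _ φ).trans ?_)
  simp
  linarith

instance : Nontrivial Hp := by
  refine ⟨(memLp_indicator_const 2 (measurableSet_Ioo (a := (0 : ℝ)) (b := 1)) (1 : ℂ)
    (Or.inr ?_)).toLp _, 0, fun h => ?_⟩
  · exact ((Measure.restrict_apply_le _ _).trans_lt (by simp)).ne
  · have h2 := congrArg norm h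
    rw [Lp.norm_toLp, eLpNorm_indicator_const measurableSet_Ioo (by simp) (by simp),
      Measure.restrict_apply measurableSet_Ioo] at h2
    rw [Set.inter_eq_left.2 (fun x hx => hx.1)] at h2
    simp at h2

end Operators

section
open ComplexConjugate Topology

/-- A square-integrable function supported in the block `[a, 4a)`. -/
structure IsBlock (a : ℝ) (w : ℝ → ℂ) : Prop where
  pos : 0 < a
  measurable : Measurable w
  eq_zero : ∀ k, k ∉ Set.Ico a (4 * a) → w k = 0
  integrable_sq : Integrable (fun k => ‖w k‖ ^ 2)

/-- The squared `L²` norm. -/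
def normSq (w : ℝ → ℂ) : ℝ := ∫ k, ‖w k‖ ^ 2

/-- Up to normalisation, the value at the origin at time `t` of the wave function with momentum
amplitude `w`. -/
def trace (w : ℝ → ℂ) (t : ℝ) : ℂ := ∫ k : ℝ, Complex.exp (-Complex.I * (k : ℂ) ^ 2 * (t : ℂ)) * w k

/-- Up to normalisation, the value at position `x` and time `t` of the wave function with momentum
amplitude `w`. -/
def wave (w : ℝ → ℂ) (t x : ℝ) : ℂ :=
  ∫ k : ℝ, Complex.exp (Complex.I * (x : ℂ) * (k : ℂ)) *
    (Complex.exp (-Complex.I * (k : ℂ) ^ 2 * (t : ℂ)) * w k)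

/-- The (sesquilinear) probability current at the origin, up to a factor `-1/(2π)`. -/
def current (φ ψ : ℝ → ℂ) (t : ℝ) : ℂ :=
  conj (trace (fun k => (k : ℂ) * φ k) t) * trace ψ t
    + conj (trace φ t) * trace (fun k => (k : ℂ) * ψ k) t

lemma norm_exp_phase (k t : ℝ) : ‖Complex.exp (-Complex.I * (k : ℂ) ^ 2 * (t : ℂ))‖ = 1 := by
  rw [show -Complex.I * (k : ℂ) ^ 2 * (t : ℂ) = ((-(k ^ 2 * t) : ℝ) : ℂ) * Complex.I by
    push_cast; ring, Complex.norm_exp_ofReal_mul_I]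

lemma norm_exp_phase_sub (k l t : ℝ) :
    ‖Complex.exp (Complex.I * ((k : ℂ) ^ 2 - (l : ℂ) ^ 2) * (t : ℂ))‖ = 1 := by
  rw [show Complex.I * ((k : ℂ) ^ 2 - (l : ℂ) ^ 2) * (t : ℂ)
    = (((k ^ 2 - l ^ 2) * t : ℝ) : ℂ) * Complex.I by push_cast; ring, Complex.norm_exp_ofReal_mul_I]

lemma norm_exp_position_sub (k l x : ℝ) :
    ‖Complex.exp (Complex.I * ((k : ℂ) - (l : ℂ)) * (x : ℂ))‖ = 1 := by
  rw [show Complex.I * ((k : ℂ) - (l : ℂ)) * (x : ℂ)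
    = (((k - l) * x : ℝ) : ℂ) * Complex.I by push_cast; ring, Complex.norm_exp_ofReal_mul_I]

lemma two_pi_rpow_sq : ((2 * Real.pi) ^ (-(1/2) : ℝ)) ^ 2 = (2 * Real.pi)⁻¹ := by
  rw [← Real.rpow_natCast, ← Real.rpow_mul (by positivity)]
  norm_num [Real.rpow_neg_one]

lemma norm_sq_eq_integral {μ : Measure ℝ} (f : Lp ℂ 2 μ) : ‖f‖ ^ 2 = ∫ x, ‖f x‖ ^ 2 ∂μ := by
  have h1 : ‖f‖ ^ 2 = (inner ℂ f f).re := by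
    rw [inner_self_eq_norm_sq_to_K]
    norm_cast
  have h2 : inner ℂ f f = ((∫ x, ‖f x‖ ^ 2 ∂μ : ℝ) : ℂ) := by
    rw [L2.inner_def, ← integral_complex_ofReal]
    refine integral_congr_ae (.of_forall fun x => ?_)
    simp only [inner_self_eq_norm_sq_to_K]
    norm_cast
  rw [h1, h2, Complex.ofReal_re]

lemma normSq_nonneg (w : ℝ → ℂ) : 0 ≤ normSq w := integral_nonneg fun _ => by positivity

namespace IsBlock
variable {a b : ℝ} {w φ ψ : ℝ → ℂ}

lemma memLp (h : IsBlock a w) : MemLp w 2 volume :=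
  (memLp_two_iff_integrable_sq_norm h.measurable.aestronglyMeasurable).2 h.integrable_sq

lemma memLp_restrict (h : IsBlock a w) : MemLp w 2 μp := h.memLp.restrict _

lemma integrable (h : IsBlock a w) : Integrable w := by
  have h1 : IntegrableOn w (Set.Ico a (4 * a)) :=
    (h.memLp.restrict (Set.Ico a (4 * a))).integrable (by norm_num)
  rwa [integrableOn_iff_integrable_of_support_subset] at h1
  intro k hk
  by_contra hk'
  exact hk (h.eq_zero k hk')

/-- The element of `L²((0,∞))` given by a block function. -/
def toHp (h : IsBlock a w) : Hp := h.memLp_restrict.toLp w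

lemma coeFn_toHp (h : IsBlock a w) : h.toHp =ᵐ[μp] w := h.memLp_restrict.coeFn_toLp

lemma setIntegral_Ioi {G : Type*} [NormedAddCommGroup G] [NormedSpace ℝ G] (h : IsBlock a w)
    {f : ℝ → G} (hf : ∀ k, w k = 0 → f k = 0) :
    ∫ k in Set.Ioi 0, f k = ∫ k, f k := by
  refine setIntegral_eq_integral_of_forall_compl_eq_zero fun k hk => hf k (h.eq_zero k fun hk' => ?_)
  exact hk (lt_of_lt_of_le h.pos hk'.1)

lemma norm_toHp_sq (h : IsBlock a w) : ‖h.toHp‖ ^ 2 = normSq w := by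
  rw [norm_sq_eq_integral, normSq, ← h.setIntegral_Ioi (fun k hk => by simp [hk])]
  apply integral_congr_ae
  filter_upwards [h.coeFn_toHp] with k hk
  rw [hk]

lemma mul (h : IsBlock a w) {g : ℝ → ℂ} (hg : Measurable g) {C : ℝ}
    (hC : ∀ k ∈ Set.Ico a (4 * a), ‖g k‖ ≤ C) :
    IsBlock a (fun k => g k * w k) ∧ normSq (fun k => g k * w k) ≤ C ^ 2 * normSq w := by
  have hb : ∀ k, ‖g k * w k‖ ^ 2 ≤ C ^ 2 * ‖w k‖ ^ 2 := by
    intro k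
    by_cases hk : k ∈ Set.Ico a (4 * a)
    · rw [norm_mul, mul_pow]
      gcongr
      exact hC k hk
    · simp [h.eq_zero k hk]
  have hi : Integrable (fun k => ‖g k * w k‖ ^ 2) := by
    refine (h.integrable_sq.const_mul (C ^ 2)).mono'
      ((hg.mul h.measurable).norm.pow_const 2).aestronglyMeasurable (.of_forall fun k => ?_)
    rw [Real.norm_of_nonneg (by positivity)]
    exact hb k
  refine ⟨⟨h.pos, hg.mul h.measurable, fun k hk => by simp [h.eq_zero k hk], hi⟩, ?_⟩
  unfold normSq
  rw [← integral_const_mul]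
  exact integral_mono hi (h.integrable_sq.const_mul _) hb

lemma momentum (h : IsBlock a w) :
    IsBlock a (fun k => (k : ℂ) * w k) ∧
      normSq (fun k => (k : ℂ) * w k) ≤ (4 * a) ^ 2 * normSq w := by
  refine h.mul (g := fun k => (k : ℂ)) Complex.measurable_ofReal fun k hk => ?_
  rw [Complex.norm_real, Real.norm_of_nonneg (h.pos.le.trans hk.1)]
  exact hk.2.le

lemma trace_apply (h : IsBlock a w) (t : ℝ) : trace w t = ∫ k in Set.Ioi (0 : ℝ),
    Complex.exp (-Complex.I * (k : ℂ) ^ 2 * (t : ℂ)) * w k :=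
  (h.setIntegral_Ioi fun k hk => by simp [hk]).symm

lemma integrable_exp_mul (h : IsBlock a w) (t : ℝ) :
    Integrable (fun k : ℝ => Complex.exp (-Complex.I * (k : ℂ) ^ 2 * (t : ℂ)) * w k) := by
  refine h.integrable.norm.mono' ?_ (.of_forall fun k => ?_)
  · exact (Measurable.mul (by fun_prop) h.measurable).aestronglyMeasurable
  · rw [norm_mul, norm_exp_phase, one_mul]

lemma continuous_trace (h : IsBlock a w) : Continuous (trace w) := by
  refine continuous_of_dominated (bound := fun k => ‖w k‖) (fun t => ?_) (fun t => ?_)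
    h.integrable.norm (.of_forall fun k => ?_)
  · exact (h.integrable_exp_mul t).aestronglyMeasurable
  · refine .of_forall fun k => ?_
    rw [norm_mul, norm_exp_phase, one_mul]
  · fun_prop

lemma continuous_current (hφ : IsBlock a φ) (hψ : IsBlock b ψ) : Continuous (current φ ψ) := by
  have h1 := hφ.continuous_trace
  have h2 := hψ.continuous_trace
  have h3 := hφ.momentum.1.continuous_trace
  have h4 := hψ.momentum.1.continuous_trace
  unfold current
  exact ((Complex.continuous_conj.comp h3).mul h2).add ((Complex.continuous_conj.comp h1).mul h4)

lemma integrable_prod (hφ : IsBlock a φ) (hψ : IsBlock b ψ) :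
    Integrable (fun p : ℝ × ℝ => conj (φ p.1) * ψ p.2) (volume.prod volume) := by
  refine Integrable.mul_prod (f := fun k => conj (φ k)) ?_ hψ.integrable
  exact (Complex.conjLIE.toContinuousLinearEquiv.integrable_comp_iff).2 hφ.integrable

lemma integrable_prod_momentum (hφ : IsBlock a φ) (hψ : IsBlock b ψ) :
    Integrable (fun p : ℝ × ℝ => (conj (φ p.1) * ψ p.2) * ((p.1 : ℂ) + (p.2 : ℂ)))
      (volume.prod volume) := by
  refine ((hφ.momentum.1.integrable_prod hψ).add (hφ.integrable_prod hψ.momentum.1)).congr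
    (.of_forall fun p => ?_)
  simp
  ring

lemma conj_trace_mul_trace (φ ψ : ℝ → ℂ) (t : ℝ) :
    conj (trace φ t) * trace ψ t = ∫ p : ℝ × ℝ, (conj (φ p.1) * ψ p.2) *
      Complex.exp (Complex.I * ((p.1 : ℂ) ^ 2 - (p.2 : ℂ) ^ 2) * (t : ℂ)) := by
  unfold trace
  rw [← integral_conj, ← integral_prod_mul]
  refine integral_congr_ae (.of_forall fun p => ?_)
  beta_reduce
  rw [map_mul, ← Complex.exp_conj, show Complex.I * ((p.1 : ℂ) ^ 2 - (p.2 : ℂ) ^ 2) * (t : ℂ)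
    = conj (-Complex.I * (p.1 : ℂ) ^ 2 * (t : ℂ)) + (-Complex.I * (p.2 : ℂ) ^ 2 * (t : ℂ)) by
      simp; ring, Complex.exp_add]
  ring

lemma conj_wave_mul_wave (φ ψ : ℝ → ℂ) (t x : ℝ) :
    conj (wave φ t x) * wave ψ t x = ∫ p : ℝ × ℝ, (conj (φ p.1) * ψ p.2) *
      Complex.exp (Complex.I * ((p.1 : ℂ) ^ 2 - (p.2 : ℂ) ^ 2) * (t : ℂ)) *
      Complex.exp (Complex.I * ((p.2 : ℂ) - (p.1 : ℂ)) * (x : ℂ)) := by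
  unfold wave
  rw [← integral_conj, ← integral_prod_mul]
  refine integral_congr_ae (.of_forall fun p => ?_)
  beta_reduce
  rw [map_mul, map_mul, ← Complex.exp_conj, ← Complex.exp_conj,
    show Complex.I * ((p.1 : ℂ) ^ 2 - (p.2 : ℂ) ^ 2) * (t : ℂ)
    = conj (-Complex.I * (p.1 : ℂ) ^ 2 * (t : ℂ)) + (-Complex.I * (p.2 : ℂ) ^ 2 * (t : ℂ)) by
      simp; ring, Complex.exp_add,
    show Complex.I * ((p.2 : ℂ) - (p.1 : ℂ)) * (x : ℂ)
    = conj (Complex.I * (x : ℂ) * (p.1 : ℂ)) + (Complex.I * (x : ℂ) * (p.2 : ℂ)) by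
      simp; ring, Complex.exp_add]
  ring

lemma current_eq (hφ : IsBlock a φ) (hψ : IsBlock b ψ) (t : ℝ) :
    current φ ψ t = ∫ p : ℝ × ℝ, (conj (φ p.1) * ψ p.2) * ((p.1 : ℂ) + (p.2 : ℂ)) *
      Complex.exp (Complex.I * ((p.1 : ℂ) ^ 2 - (p.2 : ℂ) ^ 2) * (t : ℂ)) := by
  unfold current
  rw [conj_trace_mul_trace, conj_trace_mul_trace, ← integral_add]
  · refine integral_congr_ae (.of_forall fun p => ?_)
    simp
    ring
  · refine (hφ.momentum.1.integrable_prod hψ).mul_bdd (c := 1) ?_ (.of_forall fun p => ?_)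
    · fun_prop
    · exact (norm_exp_phase_sub _ _ _).le
  · refine (hφ.integrable_prod hψ.momentum.1).mul_bdd (c := 1) ?_ (.of_forall fun p => ?_)
    · fun_prop
    · exact (norm_exp_phase_sub _ _ _).le


lemma integral_wave_mul_exp (hφ : IsBlock a φ) (hψ : IsBlock b ψ) (t : ℝ) {ε : ℝ} (hε : 0 < ε) :
    ∫ x in Set.Iic (0 : ℝ), (Real.exp (ε * x) : ℂ) * (conj (wave φ t x) * wave ψ t x) =
      ∫ p : ℝ × ℝ, (conj (φ p.1) * ψ p.2) *
        Complex.exp (Complex.I * ((p.1 : ℂ) ^ 2 - (p.2 : ℂ) ^ 2) * (t : ℂ)) /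
        ((ε : ℂ) + Complex.I * ((p.2 : ℂ) - (p.1 : ℂ))) := by
  have hexp : IntegrableOn (fun x : ℝ => (Real.exp (ε * x) : ℂ)) (Set.Iic 0) :=
    (integrableOn_exp_mul_Iic hε 0).ofReal
  have h1 : Integrable (fun q : ℝ × (ℝ × ℝ) => (Real.exp (ε * q.1) : ℂ) *
      ((conj (φ q.2.1) * ψ q.2.2) *
      Complex.exp (Complex.I * ((q.2.1 : ℂ) ^ 2 - (q.2.2 : ℂ) ^ 2) * (t : ℂ)) *
      Complex.exp (Complex.I * ((q.2.2 : ℂ) - (q.2.1 : ℂ)) * (q.1 : ℂ))))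
      ((volume.restrict (Set.Iic (0 : ℝ))).prod (volume.prod volume)) := by
    have h2 := ((hexp.mul_prod (hφ.integrable_prod hψ)).mul_bdd (c := 1)
      (g := fun q : ℝ × (ℝ × ℝ) =>
        Complex.exp (Complex.I * ((q.2.1 : ℂ) ^ 2 - (q.2.2 : ℂ) ^ 2) * (t : ℂ)))
        (by fun_prop) (.of_forall fun q => (norm_exp_phase_sub _ _ _).le)).mul_bdd (c := 1)
      (g := fun q : ℝ × (ℝ × ℝ) =>
        Complex.exp (Complex.I * ((q.2.2 : ℂ) - (q.2.1 : ℂ)) * (q.1 : ℂ)))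
        (by fun_prop) (.of_forall fun q => (norm_exp_position_sub _ _ _).le)
    refine h2.congr (.of_forall fun q => ?_)
    ring
  simp_rw [conj_wave_mul_wave, ← integral_const_mul]
  rw [integral_integral_swap h1]
  refine integral_congr_ae (.of_forall fun p => ?_)
  beta_reduce
  set z : ℂ := (ε : ℂ) + Complex.I * ((p.2 : ℂ) - (p.1 : ℂ)) with hz
  have hre : 0 < z.re := by simp [hz, hε]
  have h3 := integral_exp_mul_complex_Iic hre 0
  simp only [Complex.ofReal_zero, mul_zero, Complex.exp_zero] at h3
  rw [div_eq_mul_one_div _ z, ← h3, ← integral_const_mul]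
  refine integral_congr_ae (.of_forall fun x => ?_)
  simp only
  rw [show z * (x : ℂ) = ((ε * x : ℝ) : ℂ) + Complex.I * ((p.2 : ℂ) - (p.1 : ℂ)) * (x : ℂ) by
    rw [hz]; push_cast; ring, Complex.exp_add, Complex.ofReal_exp]
  ring

lemma integral_phase (k l t₁ t₂ : ℝ) :
    Complex.exp (Complex.I * ((k : ℂ) ^ 2 - (l : ℂ) ^ 2) * (t₂ : ℂ)) -
      Complex.exp (Complex.I * ((k : ℂ) ^ 2 - (l : ℂ) ^ 2) * (t₁ : ℂ)) =
    - (Complex.I * ((l : ℂ) - (k : ℂ))) * (((k : ℂ) + (l : ℂ)) * ∫ s in t₁..t₂,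
      Complex.exp (Complex.I * ((k : ℂ) ^ 2 - (l : ℂ) ^ 2) * (s : ℂ))) := by
  by_cases h : Complex.I * ((k : ℂ) ^ 2 - (l : ℂ) ^ 2) = 0
  · have h' : (Complex.I * ((l : ℂ) - (k : ℂ))) * ((k : ℂ) + (l : ℂ)) = 0 := by
      linear_combination -h
    rw [h, neg_mul, ← mul_assoc, h']
    simp
  · rw [integral_exp_mul_complex h, ← mul_assoc, show -(Complex.I * ((l : ℂ) - (k : ℂ))) *
      ((k : ℂ) + (l : ℂ)) = Complex.I * ((k : ℂ) ^ 2 - (l : ℂ) ^ 2) by ring, mul_div_cancel₀ _ h]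

lemma tendsto_integral_wave (hφ : IsBlock a φ) (hψ : IsBlock b ψ) {t₁ t₂ : ℝ} (ht : t₁ ≤ t₂) :
    Tendsto (fun ε : ℝ =>
      (∫ x in Set.Iic (0 : ℝ), (Real.exp (ε * x) : ℂ) * (conj (wave φ t₂ x) * wave ψ t₂ x)) -
      ∫ x in Set.Iic (0 : ℝ), (Real.exp (ε * x) : ℂ) * (conj (wave φ t₁ x) * wave ψ t₁ x))
      (𝓝[>] 0) (𝓝 (-∫ s in t₁..t₂, current φ ψ s)) := by
  set F : ℝ × ℝ → ℂ := fun p => (conj (φ p.1) * ψ p.2) * ((p.1 : ℂ) + (p.2 : ℂ)) with hF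
  have hFi : Integrable F (volume.prod volume) := hφ.integrable_prod_momentum hψ
  set J : ℝ × ℝ → ℂ := fun p => ∫ s in t₁..t₂,
      Complex.exp (Complex.I * ((p.1 : ℂ) ^ 2 - (p.2 : ℂ) ^ 2) * (s : ℂ)) with hJ
  have hJb : ∀ p, ‖J p‖ ≤ t₂ - t₁ := by
    intro p
    have := intervalIntegral.norm_integral_le_of_norm_le_const (a := t₁) (b := t₂) (C := 1)
      (f := fun s : ℝ => Complex.exp (Complex.I * ((p.1 : ℂ) ^ 2 - (p.2 : ℂ) ^ 2) * (s : ℂ)))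
      (fun s _ => (norm_exp_phase_sub _ _ _).le)
    rwa [one_mul, abs_of_nonneg (sub_nonneg.2 ht)] at this
  have hJc : Continuous J := by
    refine intervalIntegral.continuous_parametric_intervalIntegral_of_continuous' ?_ _ _
    fun_prop
  have hlim : -∫ s in t₁..t₂, current φ ψ s = ∫ p, -(F p * J p) := by
    rw [integral_neg]
    congr 1
    simp_rw [hφ.current_eq hψ]
    rw [intervalIntegral.integral_of_le ht, integral_integral_swap]
    · refine integral_congr_ae (.of_forall fun p => ?_)
      simp only [hJ]
      rw [intervalIntegral.integral_of_le ht, ← integral_const_mul]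
    · have h1 : Integrable (fun _ : ℝ => (1 : ℂ)) (volume.restrict (Set.Ioc t₁ t₂)) :=
        integrable_const _
      refine ((h1.mul_prod hFi).mul_bdd (c := 1)
        (g := fun q : ℝ × (ℝ × ℝ) =>
          Complex.exp (Complex.I * ((q.2.1 : ℂ) ^ 2 - (q.2.2 : ℂ) ^ 2) * (q.1 : ℂ)))
        (by fun_prop) (.of_forall fun q => (norm_exp_phase_sub _ _ _).le)).congr
        (.of_forall fun q => ?_)
      simp [hF, Function.uncurry]
  rw [hlim]
  set z : ℝ → ℝ × ℝ → ℂ := fun ε p => (ε : ℂ) + Complex.I * ((p.2 : ℂ) - (p.1 : ℂ)) with hz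
  have hEq : ∀ ε > (0 : ℝ), (∫ p, -(F p * J p) * (Complex.I * ((p.2 : ℂ) - (p.1 : ℂ)) / z ε p)) =
      (∫ x in Set.Iic (0 : ℝ), (Real.exp (ε * x) : ℂ) * (conj (wave φ t₂ x) * wave ψ t₂ x)) -
      ∫ x in Set.Iic (0 : ℝ), (Real.exp (ε * x) : ℂ) * (conj (wave φ t₁ x) * wave ψ t₁ x) := by
    intro ε hε
    have hInt : ∀ t : ℝ, Integrable (fun p : ℝ × ℝ => (conj (φ p.1) * ψ p.2) *
        Complex.exp (Complex.I * ((p.1 : ℂ) ^ 2 - (p.2 : ℂ) ^ 2) * (t : ℂ)) / z ε p)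
        (volume.prod volume) := by
      intro t
      simp_rw [div_eq_mul_inv]
      refine ((hφ.integrable_prod hψ).mul_bdd (c := 1) (by fun_prop)
        (.of_forall fun p => (norm_exp_phase_sub _ _ _).le)).mul_bdd (c := ε⁻¹) ?_
        (.of_forall fun p => ?_)
      · exact (Measurable.inv (by fun_prop)).aestronglyMeasurable
      · rw [norm_inv]
        gcongr
        have := Complex.abs_re_le_norm (z ε p)
        simp [hz, abs_of_pos hε] at this ⊢
        exact this
    rw [hφ.integral_wave_mul_exp hψ t₂ hε, hφ.integral_wave_mul_exp hψ t₁ hε]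
    refine Eq.trans ?_ (integral_sub (hInt t₂) (hInt t₁))
    refine integral_congr_ae (.of_forall fun p => ?_)
    have h1 := integral_phase p.1 p.2 t₁ t₂
    simp only [hF, hJ]
    rw [← sub_div, ← mul_sub, h1]
    ring
  refine Tendsto.congr' (eventually_nhdsWithin_of_forall hEq) ?_
  refine tendsto_integral_filter_of_dominated_convergence (fun p => ‖F p‖ * (t₂ - t₁)) ?_ ?_
    (hFi.norm.mul_const _) ?_
  · refine .of_forall fun ε => ?_
    refine ((hFi.aestronglyMeasurable.mul hJc.aestronglyMeasurable).neg).mul ?_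
    exact (Measurable.div (by fun_prop) (by fun_prop)).aestronglyMeasurable
  · refine eventually_nhdsWithin_of_forall fun ε hε => .of_forall fun p => ?_
    have h1 : ‖Complex.I * ((p.2 : ℂ) - (p.1 : ℂ)) / z ε p‖ ≤ 1 := by
      rw [norm_div]
      refine div_le_one_of_le₀ ?_ (norm_nonneg _)
      have := Complex.abs_im_le_norm (z ε p)
      rw [norm_mul, Complex.norm_I, one_mul, ← Complex.ofReal_sub, Complex.norm_real]
      simpa [hz] using this
    rw [norm_mul, norm_neg, norm_mul]
    calc _ ≤ ‖F p‖ * ‖J p‖ * 1 := by gcongr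
      _ ≤ _ := by rw [mul_one]; gcongr; exact hJb p
  · have hdiag : ∀ᵐ p : ℝ × ℝ ∂(volume.prod volume), p.2 ≠ p.1 := by
      rw [Measure.ae_prod_iff_ae_ae]
      · refine .of_forall fun x => ?_
        simp [ae_iff]
      · exact (measurableSet_eq_fun measurable_snd measurable_fst).compl
    filter_upwards [hdiag] with p hp
    have hne : Complex.I * ((p.2 : ℂ) - (p.1 : ℂ)) ≠ 0 :=
      mul_ne_zero Complex.I_ne_zero (sub_ne_zero.2 (by exact_mod_cast hp))
    have h1 : Tendsto (fun ε : ℝ => z ε p) (𝓝[>] 0) (𝓝 (Complex.I * ((p.2 : ℂ) - (p.1 : ℂ)))) := by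
      have : ContinuousAt (fun ε : ℝ => z ε p) 0 := by fun_prop
      have h2 := this.tendsto.mono_left (nhdsWithin_le_nhds (s := Set.Ioi 0))
      simpa [hz] using h2
    have h3 := (tendsto_const_nhds (x := -(F p * J p))).mul
      ((tendsto_const_nhds (x := Complex.I * ((p.2 : ℂ) - (p.1 : ℂ)))).div h1 hne)
    rwa [div_self hne, mul_one] at h3

variable {S : ℝ → Hp →L[ℂ] Hp} {R : Hp →L[ℂ] HL} {Pm : HL →L[ℂ] HL}

lemma coeFn_R_S (hs : Setup S R Pm) (h : IsBlock a w) (t : ℝ) :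
    R (S t h.toHp) =ᵐ[volume] fun x =>
      (((2 * Real.pi) ^ (-(1/2) : ℝ) : ℝ) : ℂ) * wave w t x := by
  have h1 : S t h.toHp =ᵐ[μp] fun k =>
      Complex.exp (-Complex.I * (k:ℂ)^2 * (t:ℂ)) * w k := by
    filter_upwards [hs.hS t h.toHp, h.coeFn_toHp] with k hk hk'
    rw [hk, hk']
  have h2 : Integrable (S t h.toHp) μp :=
    ((h.integrable_exp_mul t).restrict (s := Set.Ioi 0)).congr h1.symm
  filter_upwards [hs.hR _ h2] with x hx
  rw [hx, wave, ← h.setIntegral_Ioi (fun k hk => by simp [hk])]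
  congr 1
  apply integral_congr_ae
  filter_upwards [h1] with k hk
  rw [hk]

/-- The matrix elements of the backflow operator are time integrals of the current. -/
lemma inner_B1_eq (hs : Setup S R Pm) (hφ : IsBlock a φ) (hψ : IsBlock b ψ) {t₁ t₂ : ℝ}
    (ht : t₁ ≤ t₂) :
    inner ℂ hφ.toHp (B1 S R Pm t₁ t₂ hψ.toHp)
      = -((2 * Real.pi : ℝ) : ℂ)⁻¹ * ∫ s in t₁..t₂, current φ ψ s := by
  have hc : ((((2 * Real.pi) ^ (-(1/2) : ℝ) : ℝ) : ℂ)) ^ 2 = ((2 * Real.pi : ℝ) : ℂ)⁻¹ := by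
    rw [← Complex.ofReal_pow, ← Complex.ofReal_inv, two_pi_rpow_sq]
  set c : ℂ := ((((2 * Real.pi) ^ (-(1/2) : ℝ) : ℝ) : ℂ)) with hcdef
  have hc0 : c ≠ 0 := by
    intro h
    rw [h] at hc
    have := Real.pi_pos.ne'
    simp [this] at hc
  have hconj : conj c = c := Complex.conj_ofReal _
  have hmul : ∀ t, ∀ᵐ x : ℝ, inner ℂ (R (S t hφ.toHp) x) (R (S t hψ.toHp) x)
      = ((2 * Real.pi : ℝ) : ℂ)⁻¹ * (conj (wave φ t x) * wave ψ t x) := by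
    intro t
    filter_upwards [hφ.coeFn_R_S hs t, hψ.coeFn_R_S hs t] with x h1 h2
    rw [h1, h2, RCLike.inner_apply, ← hc, map_mul, ← hcdef, hconj]
    ring
  have hInt : ∀ t, Integrable (fun x => conj (wave φ t x) * wave ψ t x) := by
    intro t
    have h1 := (L2.integrable_inner (𝕜 := ℂ) (R (S t hφ.toHp)) (R (S t hψ.toHp))).congr (hmul t)
    rwa [integrable_const_mul_iff] at h1
    rw [← hc]
    exact (pow_ne_zero 2 hc0).isUnit
  have hinner : ∀ t, inner ℂ (R (S t hφ.toHp)) (Pm (R (S t hψ.toHp)))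
      = ((2 * Real.pi : ℝ) : ℂ)⁻¹ * ∫ x in Set.Iic (0 : ℝ), conj (wave φ t x) * wave ψ t x := by
    intro t
    rw [L2.inner_def, integral_Iic_eq_integral_Iio, ← integral_const_mul,
      ← integral_indicator measurableSet_Iio]
    apply integral_congr_ae
    filter_upwards [hmul t, hs.hPm (R (S t hψ.toHp))] with x h1 h2
    rw [h2]
    by_cases hx : x ∈ Set.Iio (0 : ℝ)
    · simp only [Set.indicator_of_mem hx, h1]
    · simp only [Set.indicator_of_notMem hx, inner_zero_right]
  have hlim : ∀ t, Tendsto (fun ε : ℝ => ∫ x in Set.Iic (0 : ℝ),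
      (Real.exp (ε * x) : ℂ) * (conj (wave φ t x) * wave ψ t x)) (𝓝[>] 0)
      (𝓝 (∫ x in Set.Iic (0 : ℝ), conj (wave φ t x) * wave ψ t x)) := by
    intro t
    refine tendsto_integral_filter_of_dominated_convergence
      (fun x => ‖conj (wave φ t x) * wave ψ t x‖) ?_ ?_ (hInt t).norm.restrict ?_
    · refine .of_forall fun ε => AEStronglyMeasurable.mul ?_ (hInt t).aestronglyMeasurable.restrict
      fun_prop
    · refine eventually_nhdsWithin_of_forall fun ε hε => ?_
      filter_upwards [ae_restrict_mem measurableSet_Iic] with x hx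
      rw [norm_mul, Complex.norm_real, Real.norm_of_nonneg (Real.exp_pos _).le]
      refine mul_le_of_le_one_left (norm_nonneg _) (Real.exp_le_one_iff.2 ?_)
      exact mul_nonpos_of_nonneg_of_nonpos (le_of_lt hε) hx
    · refine .of_forall fun x => ?_
      have h1 : ContinuousAt (fun ε : ℝ => (Real.exp (ε * x) : ℂ) *
        (conj (wave φ t x) * wave ψ t x)) 0 := by fun_prop
      have h2 := h1.tendsto.mono_left (nhdsWithin_le_nhds (s := Set.Ioi 0))
      simpa using h2
  have huniq := tendsto_nhds_unique ((hlim t₂).sub (hlim t₁)) (hφ.tendsto_integral_wave hψ ht)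
  rw [inner_B1, hinner, hinner, ← mul_sub, huniq]
  ring

end IsBlock

end

section
open ComplexConjugate Topology

/-- The energy representation of a momentum amplitude, up to normalisation. -/
def energyRep (w : ℝ → ℂ) (E : ℝ) : ℂ := ((2 * √E)⁻¹ : ℝ) * w √E

namespace IsBlock
variable {a b : ℝ} {w φ ψ : ℝ → ℂ}
variable {S : ℝ → Hp →L[ℂ] Hp} {R : Hp →L[ℂ] HL} {Pm : HL →L[ℂ] HL}

lemma measurable_energyRep (h : IsBlock a w) : Measurable (energyRep w) := by
  have := h.measurable
  unfold energyRep
  fun_prop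

lemma energyRep_sq {k : ℝ} (hk : 0 < k) (w : ℝ → ℂ) :
    energyRep w (k ^ (2 : ℝ)) = ((2 * k)⁻¹ : ℝ) * w k := by
  rw [energyRep, Real.rpow_two, Real.sqrt_sq hk.le]

lemma jacobian_mul {k : ℝ} (hk : 0 < k) (w : ℝ → ℂ) :
    ((2 : ℝ) * k ^ ((2 : ℝ) - 1)) • energyRep w (k ^ (2 : ℝ)) = w k := by
  rw [energyRep_sq hk, show (2 : ℝ) - 1 = 1 by norm_num, Real.rpow_one, Complex.real_smul,
    ← mul_assoc, ← Complex.ofReal_mul, mul_inv_cancel₀ (by positivity), Complex.ofReal_one, one_mul]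

lemma jacobian_mul_sq {k : ℝ} (hk : 0 < k) (w : ℝ → ℂ) :
    ((2 : ℝ) * k ^ ((2 : ℝ) - 1)) • ‖energyRep w (k ^ (2 : ℝ))‖ ^ 2 = (2 * k)⁻¹ * ‖w k‖ ^ 2 := by
  rw [energyRep_sq hk, show (2 : ℝ) - 1 = 1 by norm_num, Real.rpow_one, smul_eq_mul, norm_mul,
    Complex.norm_real, Real.norm_of_nonneg (by positivity)]
  field_simp

lemma integrable_energyRep (h : IsBlock a w) : Integrable (energyRep w) μp := by
  refine (integrableOn_Ioi_comp_rpow_iff (energyRep w) (two_ne_zero' ℝ)).1 ?_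
  rw [abs_two]
  exact (integrableOn_congr_fun (fun k hk => jacobian_mul hk w) measurableSet_Ioi).2
    h.integrable.integrableOn

lemma inv_mul_norm_sq_le (h : IsBlock a w) (k : ℝ) :
    (2 * k)⁻¹ * ‖w k‖ ^ 2 ≤ (2 * a)⁻¹ * ‖w k‖ ^ 2 := by
  by_cases hk : k ∈ Set.Ico a (4 * a)
  · have := h.pos
    gcongr
    exact hk.1
  · simp [h.eq_zero k hk]

lemma integrable_inv_mul_norm_sq (h : IsBlock a w) :
    Integrable (fun k => (2 * k)⁻¹ * ‖w k‖ ^ 2) := by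
  refine (h.integrable_sq.const_mul (2 * a)⁻¹).mono' ?_ (.of_forall fun k => ?_)
  · have := h.measurable
    fun_prop
  · rw [Real.norm_of_nonneg]
    · exact h.inv_mul_norm_sq_le k
    · by_cases hk : k ∈ Set.Ico a (4 * a)
      · have := h.pos.trans_le hk.1
        positivity
      · simp [h.eq_zero k hk]

lemma memLp_energyRep (h : IsBlock a w) : MemLp (energyRep w) 2 μp := by
  refine (memLp_two_iff_integrable_sq_norm h.measurable_energyRep.aestronglyMeasurable).2 ?_
  refine (integrableOn_Ioi_comp_rpow_iff (fun E => ‖energyRep w E‖ ^ 2) (two_ne_zero' ℝ)).1 ?_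
  rw [abs_two]
  exact (integrableOn_congr_fun (fun k hk => jacobian_mul_sq hk w) measurableSet_Ioi).2
    h.integrable_inv_mul_norm_sq.integrableOn

lemma integral_norm_sq_energyRep_le (h : IsBlock a w) :
    ∫ E in Set.Ioi (0 : ℝ), ‖energyRep w E‖ ^ 2 ≤ (2 * a)⁻¹ * normSq w := by
  rw [← integral_comp_rpow_Ioi_of_pos two_pos,
    setIntegral_congr_fun measurableSet_Ioi (fun k hk => jacobian_mul_sq hk w),
    h.setIntegral_Ioi (fun k hk => by simp [hk]), normSq, ← integral_const_mul]
  exact integral_mono h.integrable_inv_mul_norm_sq (h.integrable_sq.const_mul _)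
    h.inv_mul_norm_sq_le

lemma integral_exp_mul_energyRep (h : IsBlock a w) (x : ℝ) :
    ∫ E in Set.Ioi (0 : ℝ), Complex.exp (Complex.I * (x : ℂ) * (E : ℂ)) * energyRep w E
      = trace w (-x) := by
  rw [← integral_comp_rpow_Ioi_of_pos two_pos, h.trace_apply]
  refine setIntegral_congr_fun measurableSet_Ioi fun k hk => ?_
  have := jacobian_mul hk w
  rw [← mul_smul_comm, this, Real.rpow_two]
  congr 2
  push_cast
  ring

/-- Plancherel's theorem in the time-energy picture, as an inequality. -/
lemma trace_bound (hs : Setup S R Pm) (h : IsBlock a w) :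
    Integrable (fun t => ‖trace w t‖ ^ 2) ∧ normSq (trace w) ≤ Real.pi / a * normSq w := by
  set u : Hp := h.memLp_energyRep.toLp _ with hu
  have hu1 : u =ᵐ[μp] energyRep w := h.memLp_energyRep.coeFn_toLp
  have hR : ∀ᵐ x : ℝ, ‖trace w (-x)‖ ^ 2 = 2 * Real.pi * ‖R u x‖ ^ 2 := by
    filter_upwards [hs.hR u (h.integrable_energyRep.congr hu1.symm)] with x hx
    have h1 : ∫ k in Set.Ioi (0 : ℝ), Complex.exp (Complex.I * (x : ℂ) * (k : ℂ)) * u k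
        = trace w (-x) := by
      rw [← h.integral_exp_mul_energyRep]
      apply integral_congr_ae
      filter_upwards [hu1] with k hk
      rw [hk]
    rw [hx, h1, norm_mul, Complex.norm_real, mul_pow, Real.norm_of_nonneg (by positivity),
      two_pi_rpow_sq]
    field_simp
  have hInt : Integrable (fun x => ‖trace w (-x)‖ ^ 2) := by
    refine Integrable.congr ?_ (hR.mono fun x hx => hx.symm)
    exact ((memLp_two_iff_integrable_sq_norm (Lp.aestronglyMeasurable _)).1
      (Lp.memLp (R u))).const_mul _
  refine ⟨by simpa using hInt.comp_neg, ?_⟩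
  have h1 : normSq (trace w) = 2 * Real.pi * ‖u‖ ^ 2 := by
    rw [← hs.hR_isometry u, norm_sq_eq_integral, ← integral_const_mul, ← integral_congr_ae hR,
      integral_neg_eq_self (fun t => ‖trace w t‖ ^ 2) volume, normSq]
  have h2 : ‖u‖ ^ 2 ≤ (2 * a)⁻¹ * normSq w := by
    rw [norm_sq_eq_integral]
    refine le_trans (le_of_eq (integral_congr_ae ?_)) h.integral_norm_sq_energyRep_le
    filter_upwards [hu1] with k hk
    rw [hk]
  rw [h1]
  have h0 := h.pos
  calc 2 * Real.pi * ‖u‖ ^ 2 ≤ 2 * Real.pi * ((2 * a)⁻¹ * normSq w) := by gcongr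
    _ = _ := by field_simp

end IsBlock

end

section
open ComplexConjugate Topology

/-- A measurable function with values in `[0,1]` whose total variation is at most `2M`, in the
sense of `L¹`-moduli of continuity. -/
structure IsSwitch (M : ℝ) (χ : ℝ → ℝ) : Prop where
  measurable : Measurable χ
  nonneg : ∀ s, 0 ≤ χ s
  le_one : ∀ s, χ s ≤ 1
  integrable : Integrable χ
  shift : ∀ h, 0 ≤ h → ∫ s, |χ (s - h) - χ s| ≤ 2 * M * h

/-- The part of the switched current in which the momentum operator acts on `φ`. -/
def pairing (χ : ℝ → ℝ) (φ ψ : ℝ → ℂ) : ℂ :=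
  ∫ t, (χ t * trace ψ t) * conj (trace (fun k => (k : ℂ) * φ k) t)

lemma norm_integral_mul_le {u v : ℝ → ℂ} (hu : MemLp u 2) (hv : MemLp v 2) :
    ‖∫ t, u t * v t‖ ≤ √(normSq u) * √(normSq v) := by
  refine (norm_integral_le_integral_norm _).trans ?_
  simp_rw [norm_mul]
  have h := integral_mul_norm_le_Lp_mul_Lq (μ := volume) (f := u) (g := v)
    (p := 2) (q := 2) (by constructor <;> norm_num) (by simpa using hu) (by simpa using hv)
  simpa [Real.sqrt_eq_rpow, normSq] using h

namespace IsSwitch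
variable {M : ℝ} {χ : ℝ → ℝ}

lemma abs_le_one (hχ : IsSwitch M χ) (s : ℝ) : |χ s| ≤ 1 := by
  rw [abs_of_nonneg (hχ.nonneg s)]
  exact hχ.le_one s

lemma abs_sub_le_one (hχ : IsSwitch M χ) (s t : ℝ) : |χ s - χ t| ≤ 1 := by
  rw [abs_le]
  constructor <;> linarith [hχ.nonneg s, hχ.nonneg t, hχ.le_one s, hχ.le_one t]

lemma memLp_mul (hχ : IsSwitch M χ) {f : ℝ → ℂ} (hf : MemLp f 2) :
    MemLp (fun t => χ t * f t) 2 := by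
  refine hf.mono (hχ.measurable.complex_ofReal.aestronglyMeasurable.mul hf.1)
    (.of_forall fun t => ?_)
  rw [norm_mul, Complex.norm_real]
  exact mul_le_of_le_one_left (norm_nonneg _) (hχ.abs_le_one t)

lemma normSq_mul_le (hχ : IsSwitch M χ) {f : ℝ → ℂ} (hf : MemLp f 2) :
    normSq (fun t => χ t * f t) ≤ normSq f := by
  refine integral_mono ((memLp_two_iff_integrable_sq_norm (hχ.memLp_mul hf).1).1 (hχ.memLp_mul hf))
    ((memLp_two_iff_integrable_sq_norm hf.1).1 hf) fun t => ?_
  simp only [norm_mul, Complex.norm_real]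
  gcongr
  exact mul_le_of_le_one_left (norm_nonneg _) (hχ.abs_le_one t)

lemma normSq_shift_mul_le (hχ : IsSwitch M χ) {f : ℝ → ℂ} {C h : ℝ} (hC : ∀ t, ‖f t‖ ^ 2 ≤ C)
    (hh : 0 ≤ h) : normSq (fun t => (χ (t - h) - χ t) * f t) ≤ C * (2 * M * h) := by
  have hC0 : 0 ≤ C := (sq_nonneg _).trans (hC 0)
  refine le_trans ?_ (mul_le_mul_of_nonneg_left (hχ.shift h hh) hC0)
  rw [← integral_const_mul]
  refine integral_mono_of_nonneg (.of_forall fun t => by positivity)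
    (((hχ.integrable.comp_sub_right h).sub hχ.integrable).abs.const_mul C) (.of_forall fun t => ?_)
  simp only [norm_mul, mul_pow]
  rw [← Complex.ofReal_sub, Complex.norm_real, Real.norm_eq_abs, mul_comm]
  have := hχ.abs_sub_le_one (t - h) t
  gcongr
  · exact hC t
  · nlinarith [abs_nonneg (χ (t - h) - χ t)]

end IsSwitch

namespace IsBlock
variable {a b M : ℝ} {χ : ℝ → ℝ} {w φ ψ : ℝ → ℂ}
variable {S : ℝ → Hp →L[ℂ] Hp} {R : Hp →L[ℂ] HL} {Pm : HL →L[ℂ] HL}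

lemma memLp_trace (hs : Setup S R Pm) (h : IsBlock a w) : MemLp (trace w) 2 :=
  (memLp_two_iff_integrable_sq_norm h.continuous_trace.aestronglyMeasurable).2 (h.trace_bound hs).1

lemma memLp_conj_trace (hs : Setup S R Pm) (h : IsBlock a w) :
    MemLp (fun t => conj (trace w t)) 2 :=
  (h.memLp_trace hs).mono (Complex.continuous_conj.comp h.continuous_trace).aestronglyMeasurable
    (.of_forall fun t => by simp)

lemma normSq_conj_trace (w : ℝ → ℂ) : normSq (fun t => conj (trace w t)) = normSq (trace w) := by
  simp [normSq]

lemma integrable_pairing (hs : Setup S R Pm) (hχ : IsSwitch M χ) (hφ : IsBlock a φ)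
    (hψ : IsBlock b ψ) :
    Integrable (fun t => (χ t * trace ψ t) * conj (trace (fun k => (k : ℂ) * φ k) t)) :=
  (hχ.memLp_mul (hψ.memLp_trace hs)).integrable_mul (hφ.momentum.1.memLp_conj_trace hs)

lemma integral_switch_mul_current (hs : Setup S R Pm) (hχ : IsSwitch M χ) (hφ : IsBlock a φ)
    (hψ : IsBlock b ψ) :
    ∫ t, χ t * current φ ψ t = pairing χ φ ψ + conj (pairing χ ψ φ) := by
  unfold pairing
  rw [← integral_conj, ← integral_add (hφ.integrable_pairing hs hχ hψ)]
  · refine integral_congr_ae (.of_forall fun t => ?_)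
    simp [current]
    ring
  · exact (Complex.conjLIE.toContinuousLinearEquiv.integrable_comp_iff).2
      (hψ.integrable_pairing hs hχ hφ)

lemma norm_pairing_le (hs : Setup S R Pm) (hχ : IsSwitch M χ) (hφ : IsBlock a φ)
    (hψ : IsBlock b ψ) :
    ‖pairing χ φ ψ‖ ≤ 4 * Real.pi * √(a / b) * (√(normSq φ) * √(normSq ψ)) := by
  have ha := hφ.pos
  have hb := hψ.pos
  refine (norm_integral_mul_le (hχ.memLp_mul (hψ.memLp_trace hs))
    (hφ.momentum.1.memLp_conj_trace hs)).trans ?_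
  have h1 : normSq (fun t => χ t * trace ψ t) ≤ Real.pi / b * normSq ψ :=
    (hχ.normSq_mul_le (hψ.memLp_trace hs)).trans (hψ.trace_bound hs).2
  have h2 : normSq (fun t => conj (trace (fun k => (k : ℂ) * φ k) t))
      ≤ Real.pi / a * ((4 * a) ^ 2 * normSq φ) := by
    rw [normSq_conj_trace]
    refine (hφ.momentum.1.trace_bound hs).2.trans ?_
    gcongr
    exact hφ.momentum.2
  calc _ ≤ √(Real.pi / b * normSq ψ) * √(Real.pi / a * ((4 * a) ^ 2 * normSq φ)) := by gcongr
    _ = √((4 * Real.pi) ^ 2 * (a / b) * (normSq φ * normSq ψ)) := by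
      rw [← Real.sqrt_mul (by have := normSq_nonneg ψ; positivity)]
      congr 1
      field_simp
    _ = _ := by
      rw [Real.sqrt_mul (by positivity), Real.sqrt_mul (by positivity),
        Real.sqrt_sq (by positivity), Real.sqrt_mul (normSq_nonneg _)]

lemma norm_trace_sq_le (h : IsBlock a w) (t : ℝ) : ‖trace w t‖ ^ 2 ≤ 3 * a * normSq w := by
  have ha := h.pos
  set u : ℝ → ℂ := (Set.Ico a (4 * a)).indicator
    fun k => Complex.exp (-Complex.I * (k : ℂ) ^ 2 * (t : ℂ)) with hu
  have hnorm : ∀ k, ‖u k‖ ^ 2 = (Set.Ico a (4 * a)).indicator (fun _ => (1 : ℝ)) k := by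
    intro k
    by_cases hk : k ∈ Set.Ico a (4 * a)
    · rw [hu, Set.indicator_of_mem hk, Set.indicator_of_mem hk, norm_exp_phase, one_pow]
    · simp [hu, hk]
  have hInt : Integrable ((Set.Ico a (4 * a)).indicator (fun _ => (1 : ℝ))) :=
    (integrable_indicator_iff measurableSet_Ico).2 (integrableOn_const (by simp))
  have hmeas : Measurable u := Measurable.indicator (by fun_prop) measurableSet_Ico
  have hmem : MemLp u 2 := (memLp_two_iff_integrable_sq_norm hmeas.aestronglyMeasurable).2
    (by simpa only [hnorm] using hInt)
  have hN : normSq u = 3 * a := by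
    simp_rw [normSq, hnorm]
    rw [integral_indicator measurableSet_Ico]
    simp
    rw [max_eq_left (by linarith)]
    ring
  have h1 : trace w t = ∫ k, u k * w k := by
    refine integral_congr_ae (.of_forall fun k => ?_)
    by_cases hk : k ∈ Set.Ico a (4 * a)
    · simp [hu, hk]
    · simp [h.eq_zero k hk]
  have h2 := norm_integral_mul_le hmem h.memLp
  rw [← h1, hN] at h2
  calc ‖trace w t‖ ^ 2 ≤ (√(3 * a) * √(normSq w)) ^ 2 := by gcongr
    _ = _ := by rw [mul_pow, Real.sq_sqrt (by positivity), Real.sq_sqrt (normSq_nonneg w)]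

lemma trace_shift_sub (h : IsBlock a w) (t s : ℝ) : trace w (t + s) - trace w t
    = trace (fun k => (Complex.exp (-Complex.I * (k : ℂ) ^ 2 * (s : ℂ)) - 1) * w k) t := by
  unfold trace
  rw [← integral_sub (h.integrable_exp_mul _) (h.integrable_exp_mul _)]
  refine integral_congr_ae (.of_forall fun k => ?_)
  simp only
  rw [show -Complex.I * (k : ℂ) ^ 2 * ((t + s : ℝ) : ℂ) = -Complex.I * (k : ℂ) ^ 2 * (t : ℂ)
    + -Complex.I * (k : ℂ) ^ 2 * (s : ℂ) by push_cast; ring, Complex.exp_add]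
  ring

lemma norm_exp_phase_sub_one_le (k s : ℝ) :
    ‖Complex.exp (-Complex.I * (k : ℂ) ^ 2 * (s : ℂ)) - 1‖ ≤ k ^ 2 * |s| := by
  have := Real.norm_exp_I_mul_ofReal_sub_one_le (x := -(k ^ 2 * s))
  rw [show -Complex.I * (k : ℂ) ^ 2 * (s : ℂ) = Complex.I * ((-(k ^ 2 * s) : ℝ) : ℂ) by
    push_cast; ring]
  simpa [abs_mul] using this

/-- On a block `[a, 4a)` the phase increment over the time step `1/(16a²)` stays away from `0`. -/
lemma le_norm_exp_phase_sub_one (ha : 0 < a) {k : ℝ} (hk : k ∈ Set.Ico a (4 * a)) :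
    1 / 32 ≤ ‖Complex.exp (-Complex.I * (k : ℂ) ^ 2 * ((1 / (16 * a ^ 2) : ℝ) : ℂ)) - 1‖ := by
  set x : ℝ := k ^ 2 * (1 / (16 * a ^ 2)) with hx
  have hk0 : 0 < k := ha.trans_le hk.1
  have h1 : 1 / 16 ≤ x := by
    rw [hx, mul_one_div, div_le_div_iff₀ (by norm_num) (by positivity)]
    nlinarith [hk.1]
  have h2 : x ≤ 1 := by
    rw [hx, mul_one_div, div_le_one (by positivity)]
    nlinarith [hk.2]
  have h3 := Real.sin_gt_sub_cube (x := x) (by linarith)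
  have h4 := Complex.abs_im_le_norm
    (Complex.exp (-Complex.I * (k : ℂ) ^ 2 * ((1 / (16 * a ^ 2) : ℝ) : ℂ)) - 1)
  rw [show -Complex.I * (k : ℂ) ^ 2 * ((1 / (16 * a ^ 2) : ℝ) : ℂ) = ((-x : ℝ) : ℂ) * Complex.I by
    rw [hx]; push_cast; ring] at h4 ⊢
  rw [Complex.sub_im, Complex.exp_ofReal_mul_I_im, Complex.one_im, Real.sin_neg, sub_zero,
    abs_neg] at h4
  have h5 := le_abs_self (Real.sin x)
  have h6 : x ^ 3 ≤ x := by nlinarith [mul_nonneg (by linarith : 0 ≤ x) (by linarith : 0 ≤ 1 - x)]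
  linarith

end IsBlock

end

section
open ComplexConjugate Topology

lemma sqrt_mul_sqrt_le {X Y K Z : ℝ} (hX : 0 ≤ X) (hK : 0 ≤ K) (h : X * Y ≤ K ^ 2 * Z) :
    √X * √Y ≤ K * √Z := by
  calc √X * √Y = √(X * Y) := (Real.sqrt_mul hX Y).symm
    _ ≤ √(K ^ 2 * Z) := Real.sqrt_le_sqrt h
    _ = K * √Z := by rw [Real.sqrt_mul (sq_nonneg K), Real.sqrt_sq hK]

namespace IsBlock
variable {a b M : ℝ} {χ : ℝ → ℝ} {w φ ψ : ℝ → ℂ}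
variable {S : ℝ → Hp →L[ℂ] Hp} {R : Hp →L[ℂ] HL} {Pm : HL →L[ℂ] HL}

/-- The trace of `kφ` is an increment of the trace of another block of comparable size. -/
lemma exists_trace_momentum_eq (hφ : IsBlock a φ) :
    ∃ γ, IsBlock a γ ∧ normSq γ ≤ (128 * a) ^ 2 * normSq φ ∧
      ∀ t, trace (fun k => (k : ℂ) * φ k) t
        = trace γ (t + 1 / (16 * a ^ 2)) - trace γ t := by
  have ha := hφ.pos
  have h := hφ.mul (C := 128 * a) (g := fun k : ℝ => (k : ℂ) *
    (Complex.exp (-Complex.I * (k : ℂ) ^ 2 * ((1 / (16 * a ^ 2) : ℝ) : ℂ)) - 1)⁻¹)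
    (by fun_prop) fun k hk => by
      have h1 := le_norm_exp_phase_sub_one ha hk
      have h2 := inv_anti₀ (by norm_num) h1
      rw [norm_mul, norm_inv, Complex.norm_real, Real.norm_of_nonneg (ha.le.trans hk.1)]
      calc _ ≤ (4 * a) * (1 / 32)⁻¹ := by gcongr; exact hk.2.le
        _ = _ := by ring
  refine ⟨_, h.1, h.2, fun t => ?_⟩
  rw [h.1.trace_shift_sub]
  congr 1
  ext k
  by_cases hk : k ∈ Set.Ico a (4 * a)
  · have h1 := le_norm_exp_phase_sub_one ha hk
    have h2 : Complex.exp (-Complex.I * (k : ℂ) ^ 2 * ((1 / (16 * a ^ 2) : ℝ) : ℂ)) - 1 ≠ 0 := by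
      intro h0
      rw [h0, norm_zero] at h1
      norm_num at h1
    generalize Complex.exp (-Complex.I * (k : ℂ) ^ 2 * ((1 / (16 * a ^ 2) : ℝ) : ℂ)) - 1 = z
      at h2 ⊢
    field_simp
  · simp [hφ.eq_zero k hk]

lemma norm_pairing_le_of_le (hs : Setup S R Pm) (hM : 1 ≤ M) (hχ : IsSwitch M χ)
    (hφ : IsBlock a φ) (hψ : IsBlock b ψ) (hab : b ≤ a) :
    ‖pairing χ φ ψ‖ ≤ 600 * √M * √(b / a) * (√(normSq φ) * √(normSq ψ)) := by
  have ha := hφ.pos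
  have hb := hψ.pos
  have hNφ := normSq_nonneg φ
  have hNψ := normSq_nonneg ψ
  obtain ⟨γ, hγ, hγn, hγt⟩ := hφ.exists_trace_momentum_eq
  set h : ℝ := 1 / (16 * a ^ 2) with hh
  have hpos : 0 < h := by positivity
  have hΓ := hγ.memLp_conj_trace hs
  have hΓn : normSq (fun t => conj (trace γ t)) ≤ Real.pi / a * ((128 * a) ^ 2 * normSq φ) := by
    rw [normSq_conj_trace]
    refine (hγ.trace_bound hs).2.trans ?_
    gcongr
  have hΓh : MemLp (fun t => conj (trace γ (t + h))) 2 :=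
    hΓ.comp_measurePreserving (measurePreserving_add_right volume h)
  have hf := hψ.memLp_trace hs
  have hfh : MemLp (fun t => trace ψ (t - h)) 2 :=
    hf.comp_measurePreserving (measurePreserving_sub_right volume h)
  obtain ⟨hδ, hδn⟩ := hψ.mul (C := (b / a) ^ 2) (g := fun k : ℝ =>
    Complex.exp (-Complex.I * (k : ℂ) ^ 2 * ((-h : ℝ) : ℂ)) - 1) (by fun_prop) fun k hk => by
      refine (norm_exp_phase_sub_one_le k (-h)).trans ?_
      rw [abs_neg, abs_of_pos hpos]
      calc k ^ 2 * h ≤ (4 * b) ^ 2 * h := by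
            have := hb.le.trans hk.1; have := hk.2; gcongr
        _ = (b / a) ^ 2 := by rw [hh]; field_simp; norm_num
  set δ := fun k : ℝ => (Complex.exp (-Complex.I * (k : ℂ) ^ 2 * ((-h : ℝ) : ℂ)) - 1) * ψ k
  have hδt : ∀ t, trace ψ (t - h) - trace ψ t = trace δ t := fun t => by
    rw [sub_eq_add_neg t h]; exact hψ.trace_shift_sub t (-h)
  have hχh : MemLp (fun t => ((χ (t - h) : ℂ) - χ t) * trace ψ (t - h)) 2 := by
    refine hfh.mono (AEStronglyMeasurable.mul ?_ hfh.1) (.of_forall fun t => ?_)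
    · have := hχ.measurable
      exact (by fun_prop : Measurable fun t => ((χ (t - h) : ℂ) - χ t)).aestronglyMeasurable
    · rw [norm_mul, ← Complex.ofReal_sub, Complex.norm_real]
      exact mul_le_of_le_one_left (norm_nonneg _) (hχ.abs_sub_le_one _ _)
  have hχδ := hχ.memLp_mul (hδ.memLp_trace hs)
  have key : pairing χ φ ψ
      = (∫ t, ((χ (t - h) : ℂ) - χ t) * trace ψ (t - h) * conj (trace γ t))
        + ∫ t, (χ t * trace δ t) * conj (trace γ t) := by
    have i1 : Integrable fun t => (χ t * trace ψ t) * conj (trace γ t) :=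
      (hχ.memLp_mul hf).integrable_mul hΓ
    have i2 : Integrable fun t => (χ t * trace ψ t) * conj (trace γ (t + h)) :=
      (hχ.memLp_mul hf).integrable_mul hΓh
    have i3 : Integrable fun t => ((χ (t - h) : ℂ) - χ t) * trace ψ (t - h) * conj (trace γ t) :=
      hχh.integrable_mul hΓ
    have i4 : Integrable fun t => (χ t * trace δ t) * conj (trace γ t) := hχδ.integrable_mul hΓ
    rw [← integral_add i3 i4]
    have e1 : pairing χ φ ψ = (∫ t, (χ t * trace ψ t) * conj (trace γ (t + h)))
        - ∫ t, (χ t * trace ψ t) * conj (trace γ t) := by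
      rw [← integral_sub i2 i1]
      refine integral_congr_ae (.of_forall fun t => ?_)
      simp only [hγt, map_sub]
      ring
    have e2 := integral_sub_right_eq_self (μ := volume)
      (fun t => (χ t * trace ψ t) * conj (trace γ (t + h))) h
    have hi : Integrable fun t => ((χ (t - h) : ℂ) * trace ψ (t - h)) * conj (trace γ t) := by
      simpa using i2.comp_sub_right h
    simp only [sub_add_cancel] at e2
    rw [e1, ← e2, ← integral_sub hi i1]
    refine integral_congr_ae (.of_forall fun t => ?_)
    simp only [← hδt]
    ring
  have b1 : ‖∫ t, ((χ (t - h) : ℂ) - χ t) * trace ψ (t - h) * conj (trace γ t)‖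
      ≤ 150 * √(M * (b / a) * (normSq φ * normSq ψ)) := by
    refine (norm_integral_mul_le hχh hΓ).trans ?_
    have h1 := hχ.normSq_shift_mul_le (f := fun t => trace ψ (t - h))
      (fun t => hψ.norm_trace_sq_le (t - h)) hpos.le
    refine (mul_le_mul (Real.sqrt_le_sqrt h1) (Real.sqrt_le_sqrt hΓn) (by positivity)
      (by positivity)).trans (sqrt_mul_sqrt_le (by positivity) (by norm_num) ?_)
    rw [hh, show 3 * b * normSq ψ * (2 * M * (1 / (16 * a ^ 2))) *
      (Real.pi / a * ((128 * a) ^ 2 * normSq φ)) = 6144 * Real.pi *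
        (M * (b / a) * (normSq φ * normSq ψ)) by field_simp; ring]
    gcongr
    linarith [Real.pi_lt_d2]
  have b2 : ‖∫ t, (χ t * trace δ t) * conj (trace γ t)‖
      ≤ 450 * √(M * (b / a) * (normSq φ * normSq ψ)) := by
    refine (norm_integral_mul_le hχδ hΓ).trans ?_
    have h1 : normSq (fun t => χ t * trace δ t) ≤ Real.pi / b * (((b / a) ^ 2) ^ 2 * normSq ψ) := by
      refine (hχ.normSq_mul_le (hδ.memLp_trace hs)).trans ((hδ.trace_bound hs).2.trans ?_)
      gcongr
    refine (mul_le_mul (Real.sqrt_le_sqrt h1) (Real.sqrt_le_sqrt hΓn) (by positivity)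
      (by positivity)).trans (sqrt_mul_sqrt_le (by positivity) (by norm_num) ?_)
    have hba : b / a ≤ 1 := (div_le_one ha).2 hab
    have hba0 : 0 < b / a := by positivity
    have e : Real.pi / b * (((b / a) ^ 2) ^ 2 * normSq ψ) *
      (Real.pi / a * ((128 * a) ^ 2 * normSq φ)) = (128 * Real.pi) ^ 2 *
        ((b / a) ^ 3 * (normSq φ * normSq ψ)) := by field_simp
    rw [e]
    have h3 : (b / a) ^ 3 ≤ M * (b / a) :=
      calc (b / a) ^ 3 ≤ (b / a) ^ 1 := pow_le_pow_of_le_one hba0.le hba (by norm_num)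
        _ ≤ M * (b / a) := by rw [pow_one]; exact le_mul_of_one_le_left hba0.le hM
    gcongr
    linarith [Real.pi_lt_d2]
  rw [key]
  refine (norm_add_le _ _).trans ((add_le_add b1 b2).trans_eq ?_)
  rw [Real.sqrt_mul (by positivity), Real.sqrt_mul (by positivity), Real.sqrt_mul hNφ]
  ring

/-- Off-diagonal decay of the switched current between two blocks. -/
lemma norm_integral_switch_mul_current_le (hs : Setup S R Pm) (hM : 1 ≤ M) (hχ : IsSwitch M χ)
    (hφ : IsBlock a φ) (hψ : IsBlock b ψ) (hab : b ≤ a) :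
    ‖∫ t, χ t * current φ ψ t‖
      ≤ 616 * min √(a / b) (√M * √(b / a)) * (√(normSq φ) * √(normSq ψ)) := by
  have ha := hφ.pos
  have hb := hψ.pos
  rw [hφ.integral_switch_mul_current hs hχ hψ]
  have h1 := hφ.norm_pairing_le hs hχ hψ
  have h2 := hφ.norm_pairing_le_of_le hs hM hχ hψ hab
  have h3 := hψ.norm_pairing_le hs hχ hφ
  rw [mul_comm √(normSq ψ)] at h3
  have hπ := Real.pi_lt_d2
  have hba : √(b / a) ≤ √(a / b) := Real.sqrt_le_sqrt <|
    ((div_le_one ha).2 hab).trans ((one_le_div hb).2 hab)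
  have hMb : √(b / a) ≤ √M * √(b / a) :=
    le_mul_of_one_le_left (Real.sqrt_nonneg _) (Real.one_le_sqrt.2 hM)
  set n := √(normSq φ) * √(normSq ψ)
  have hn : 0 ≤ n := by positivity
  refine (norm_add_le _ _).trans ?_
  rw [RCLike.norm_conj, mul_min_of_nonneg _ _ (by norm_num), min_mul_of_nonneg _ _ hn, le_min_iff]
  constructor
  · refine (add_le_add h1 h3).trans ?_
    calc _ = 4 * Real.pi * (√(a / b) + √(b / a)) * n := by ring
      _ ≤ 4 * 3.15 * (√(a / b) + √(a / b)) * n := by gcongr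
      _ ≤ _ := by rw [← mul_two]; gcongr ?_ * n; linarith [Real.sqrt_nonneg (a / b)]
  · refine (add_le_add h2 h3).trans ?_
    calc _ = (600 * (√M * √(b / a)) + 4 * Real.pi * √(b / a)) * n := by ring
      _ ≤ (600 * (√M * √(b / a)) + 4 * 3.15 * (√M * √(b / a))) * n := by gcongr
      _ ≤ _ := by
        gcongr ?_ * n
        linarith [mul_nonneg (Real.sqrt_nonneg M) (Real.sqrt_nonneg (b / a))]

end IsBlock

end

section
open ComplexConjugate Topology

/-- The indicator function of the union of the time intervals `(t_{2j-1}, t_{2j}]`. -/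
def switch (M : ℕ) (t : Fin (2 * M) → ℝ) (s : ℝ) : ℝ :=
  ∑ j : Fin M, (Set.Ioc (t ⟨2 * j.1, by have := j.isLt; omega⟩)
    (t ⟨2 * j.1 + 1, by have := j.isLt; omega⟩)).indicator 1 s

lemma abs_indicator_Ioc_shift_sub_le {c d h : ℝ} (hh : 0 ≤ h) (s : ℝ) :
    |(Set.Ioc c d).indicator (1 : ℝ → ℝ) (s - h) - (Set.Ioc c d).indicator 1 s|
      ≤ (Set.Ioc c (c + h)).indicator 1 s + (Set.Ioc d (d + h)).indicator 1 s := by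
  simp only [Set.indicator_apply, Set.mem_Ioc, Pi.one_apply]
  split_ifs <;> norm_num <;> grind

lemma integral_abs_indicator_Ioc_shift_sub_le {c d h : ℝ} (hh : 0 ≤ h) :
    ∫ s, |(Set.Ioc c d).indicator (1 : ℝ → ℝ) (s - h) - (Set.Ioc c d).indicator 1 s| ≤ 2 * h := by
  have hi : ∀ x y : ℝ, Integrable ((Set.Ioc x y).indicator (1 : ℝ → ℝ)) := fun x y =>
    (integrable_indicator_iff measurableSet_Ioc).2 (integrableOn_const (by simp))
  refine (integral_mono_of_nonneg (.of_forall fun s => abs_nonneg _)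
    ((hi c (c + h)).add (hi d (d + h))) (.of_forall fun s => abs_indicator_Ioc_shift_sub_le hh s)).trans_eq ?_
  simp only [Pi.add_apply]
  rw [integral_add (hi c (c + h)) (hi d (d + h)), integral_indicator_one measurableSet_Ioc,
    integral_indicator_one measurableSet_Ioc]
  simp [hh]
  ring

lemma isSwitch_switch {M : ℕ} {t : Fin (2 * M) → ℝ} (ht : t ∈ TM M) :
    IsSwitch M (switch M t) := by
  have ht' : StrictMono t := ht
  have hi : ∀ x y : ℝ, Integrable ((Set.Ioc x y).indicator (1 : ℝ → ℝ)) := fun x y =>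
    (integrable_indicator_iff measurableSet_Ioc).2 (integrableOn_const (by simp))
  refine ⟨?_, fun s => ?_, fun s => ?_, ?_, fun h hh => ?_⟩
  · exact Finset.measurable_sum _ fun j _ => measurable_one.indicator measurableSet_Ioc
  · exact Finset.sum_nonneg fun j _ => Set.indicator_nonneg (by simp) _
  · by_cases hj : ∃ j : Fin M, s ∈ Set.Ioc (t ⟨2 * j.1, by have := j.isLt; omega⟩)
      (t ⟨2 * j.1 + 1, by have := j.isLt; omega⟩)
    · obtain ⟨j, hj⟩ := hj
      rw [switch, Finset.sum_eq_single j, Set.indicator_of_mem hj, Pi.one_apply]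
      · intro i _ hij
        refine Set.indicator_of_notMem (fun hi => ?_) _
        rcases lt_or_gt_of_ne hij with h | h
        · have h' : i.1 < j.1 := h
          exact absurd (hj.1.trans_le hi.2) (ht'.monotone (Fin.mk_le_mk.2 (by omega))).not_gt
        · have h' : j.1 < i.1 := h
          exact absurd (hi.1.trans_le hj.2) (ht'.monotone (Fin.mk_le_mk.2 (by omega))).not_gt
      · simp
    · push Not at hj
      rw [switch, Finset.sum_eq_zero fun j _ => Set.indicator_of_notMem (hj j) _]
      exact zero_le_one
  · exact integrable_finsetSum _ fun j _ => hi _ _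
  · have hd : ∀ x y : ℝ, Integrable fun s =>
        |(Set.Ioc x y).indicator (1 : ℝ → ℝ) (s - h) - (Set.Ioc x y).indicator 1 s| :=
      fun x y => (((hi x y).comp_sub_right h).sub (hi x y)).abs
    calc ∫ s, |switch M t (s - h) - switch M t s|
        ≤ ∫ s, ∑ j : Fin M, |(Set.Ioc (t ⟨2 * j.1, by have := j.isLt; omega⟩)
            (t ⟨2 * j.1 + 1, by have := j.isLt; omega⟩)).indicator (1 : ℝ → ℝ) (s - h)
          - (Set.Ioc (t ⟨2 * j.1, by have := j.isLt; omega⟩)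
            (t ⟨2 * j.1 + 1, by have := j.isLt; omega⟩)).indicator (1 : ℝ → ℝ) s| := by
          refine integral_mono_of_nonneg (.of_forall fun s => abs_nonneg _)
            (integrable_finsetSum _ fun j _ => hd _ _) (.of_forall fun s => ?_)
          simp only [switch]
          rw [← Finset.sum_sub_distrib]
          exact Finset.abs_sum_le_sum_abs _ _
      _ ≤ ∑ j : Fin M, 2 * h := by
          rw [integral_finsetSum _ fun j _ => hd _ _]
          exact Finset.sum_le_sum fun j _ => integral_abs_indicator_Ioc_shift_sub_le hh
      _ = 2 * M * h := by simp; ring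

variable {S : ℝ → Hp →L[ℂ] Hp} {R : Hp →L[ℂ] HL} {Pm : HL →L[ℂ] HL}
variable {a b : ℝ} {φ ψ : ℝ → ℂ} {M : ℕ} {t : Fin (2 * M) → ℝ}

/-- The `M`-fold backflow operator is the time integral of the current over the given intervals. -/
lemma inner_BM_eq_sum (hs : Setup S R Pm) (ht : t ∈ TM M) (hφ : IsBlock a φ) (hψ : IsBlock b ψ) :
    inner ℂ hφ.toHp (BM S R Pm M t hψ.toHp) = -((2 * Real.pi : ℝ) : ℂ)⁻¹ *
      ∑ j : Fin M, ∫ s in (t ⟨2 * j.1, by have := j.isLt; omega⟩)..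
        (t ⟨2 * j.1 + 1, by have := j.isLt; omega⟩), current φ ψ s := by
  have ht' : StrictMono t := ht
  rw [BM, sum_apply, inner_sum, Finset.mul_sum]
  exact Finset.sum_congr rfl fun j _ =>
    IsBlock.inner_B1_eq hs hφ hψ (ht'.monotone (Fin.mk_le_mk.2 (by omega)))

lemma inner_BM_eq (hs : Setup S R Pm) (ht : t ∈ TM M) (hφ : IsBlock a φ) (hψ : IsBlock b ψ) :
    inner ℂ hφ.toHp (BM S R Pm M t hψ.toHp) = -((2 * Real.pi : ℝ) : ℂ)⁻¹ *
      ∫ s, switch M t s * current φ ψ s := by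
  have ht' : StrictMono t := ht
  have hc := hφ.continuous_current hψ
  have hind : ∀ x y s : ℝ, (((Set.Ioc x y).indicator (1 : ℝ → ℝ) s : ℝ) : ℂ) * current φ ψ s
      = (Set.Ioc x y).indicator (current φ ψ) s := fun x y s => by
    by_cases h : s ∈ Set.Ioc x y <;> simp [h]
  rw [inner_BM_eq_sum hs ht]
  congr 1
  simp only [switch, Complex.ofReal_sum, Finset.sum_mul, hind]
  rw [integral_finsetSum]
  · refine Finset.sum_congr rfl fun j _ => ?_
    rw [integral_indicator measurableSet_Ioc, intervalIntegral.integral_of_le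
      (ht'.monotone (Fin.mk_le_mk.2 (by omega)))]
  · exact fun j _ => (integrable_indicator_iff measurableSet_Ioc).2
      (hc.integrableOn_Icc.mono_set Set.Ioc_subset_Icc_self)

lemma IsBlock.sqrt_normSq (h : IsBlock a φ) : √(normSq φ) = ‖h.toHp‖ := by
  rw [← h.norm_toHp_sq, Real.sqrt_sq (norm_nonneg _)]

lemma norm_inner_BM_le_of_le (hs : Setup S R Pm) (hM : 1 ≤ M) (ht : t ∈ TM M) (hφ : IsBlock a φ)
    (hψ : IsBlock b ψ) (hab : b ≤ a) :
    ‖inner ℂ hφ.toHp (BM S R Pm M t hψ.toHp)‖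
      ≤ 100 * min √(a / b) (√M * √(b / a)) * (‖hφ.toHp‖ * ‖hψ.toHp‖) := by
  have h1 := hφ.norm_integral_switch_mul_current_le hs (by exact_mod_cast hM)
    (isSwitch_switch ht) hψ hab
  rw [hφ.sqrt_normSq, hψ.sqrt_normSq] at h1
  rw [inner_BM_eq hs ht, norm_mul, norm_neg, norm_inv, Complex.norm_real,
    Real.norm_of_nonneg (by positivity)]
  have hπ : (2 * Real.pi)⁻¹ ≤ 100 / 616 := by
    rw [inv_le_comm₀ (by positivity) (by norm_num)]
    linarith [Real.pi_gt_d2]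
  calc _ ≤ (100 / 616) * (616 * min √(a / b) (√M * √(b / a)) * (‖hφ.toHp‖ * ‖hψ.toHp‖)) := by
        gcongr
    _ = _ := by ring

end

section
open ComplexConjugate Topology

/-- The off-diagonal decay rate between dyadic blocks at distance `d`, for `16 ^ p` intervals. -/
def decay (p d : ℕ) : ℝ := min (2 ^ d) (4 ^ p / 2 ^ d)

lemma decay_nonneg (p d : ℕ) : 0 ≤ decay p d := by unfold decay; positivity

lemma sum_decay_le (p N : ℕ) : ∑ d ∈ Finset.range N, decay p d ≤ 3 * 2 ^ p := by
  calc ∑ d ∈ Finset.range N, decay p d ≤ ∑ d ∈ Finset.range (p + N), decay p d :=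
        Finset.sum_le_sum_of_subset_of_nonneg (Finset.range_mono (by omega))
          fun d _ _ => decay_nonneg p d
    _ = ∑ d ∈ Finset.range p, decay p d + ∑ d ∈ Finset.range N, decay p (p + d) :=
        Finset.sum_range_add _ _ _
    _ ≤ ∑ d ∈ Finset.range p, 2 ^ d + ∑ d ∈ Finset.range N, 2 ^ p * (1 / 2) ^ d := by
        gcongr with d _ d _
        · exact min_le_left _ _
        · refine (min_le_right _ _).trans_eq ?_
          rw [show (4 : ℝ) = 2 * 2 by norm_num, mul_pow, pow_add]
          field_simp
          rw [← mul_pow]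
          norm_num
    _ ≤ 2 ^ p + 2 ^ p * 2 := by
        rw [← Finset.mul_sum, geom_sum_eq (by norm_num)]
        gcongr
        · norm_num
        · exact sum_geometric_two_le N
    _ = _ := by ring

lemma sum_decay_dist_le (p N n : ℕ) (hn : n < N) :
    ∑ m ∈ Finset.range N, decay p (Nat.dist n m) ≤ 6 * 2 ^ p := by
  rw [Finset.range_eq_Ico, ← Finset.sum_Ico_consecutive _ (Nat.zero_le (n + 1)) hn,
    ← Finset.range_eq_Ico]
  have h1 : ∑ m ∈ Finset.range (n + 1), decay p (Nat.dist n m)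
      = ∑ m ∈ Finset.range (n + 1), decay p m := by
    rw [← Finset.sum_range_reflect]
    refine Finset.sum_congr rfl fun m hm => ?_
    have := Finset.mem_range.1 hm
    congr 1
    unfold Nat.dist
    omega
  have h2 : ∑ m ∈ Finset.Ico (n + 1) N, decay p (Nat.dist n m) ≤ 3 * 2 ^ p := by
    refine le_trans ?_ (sum_decay_le p (N - n))
    calc _ ≤ ∑ m ∈ Finset.Ico n N, decay p (Nat.dist n m) :=
          Finset.sum_le_sum_of_subset_of_nonneg (Finset.Ico_subset_Ico_left (by omega))
            fun d _ _ => decay_nonneg _ _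
      _ = _ := by
          rw [Finset.sum_Ico_eq_sum_range]
          refine Finset.sum_congr rfl fun m _ => ?_
          congr 1
          unfold Nat.dist
          omega
  linarith [sum_decay_le p (n + 1)]

/-- Schur test for the decay kernel. -/
lemma sum_sum_decay_mul_le (p N : ℕ) (x : ℕ → ℝ) :
    ∑ n ∈ Finset.range N, ∑ m ∈ Finset.range N, decay p (Nat.dist n m) * (x n * x m)
      ≤ 6 * 2 ^ p * ∑ n ∈ Finset.range N, x n ^ 2 := by
  have h : ∑ n ∈ Finset.range N, ∑ m ∈ Finset.range N, decay p (Nat.dist n m) * x n ^ 2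
      ≤ 6 * 2 ^ p * ∑ n ∈ Finset.range N, x n ^ 2 := by
    rw [Finset.mul_sum]
    refine Finset.sum_le_sum fun n hn => ?_
    rw [← Finset.sum_mul]
    gcongr
    exact sum_decay_dist_le p N n (Finset.mem_range.1 hn)
  have h' : ∑ n ∈ Finset.range N, ∑ m ∈ Finset.range N, decay p (Nat.dist n m) * x m ^ 2
      = ∑ n ∈ Finset.range N, ∑ m ∈ Finset.range N, decay p (Nat.dist n m) * x n ^ 2 := by
    rw [Finset.sum_comm]
    simp only [Nat.dist_comm]
  calc _ ≤ ∑ n ∈ Finset.range N, ∑ m ∈ Finset.range N,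
        (decay p (Nat.dist n m) * x n ^ 2 + decay p (Nat.dist n m) * x m ^ 2) / 2 := by
        gcongr with n _ m _
        nlinarith [mul_nonneg (decay_nonneg p (Nat.dist n m)) (sq_nonneg (x n - x m))]
    _ ≤ _ := by
        simp only [← Finset.sum_div, Finset.sum_add_distrib]
        rw [h']
        linarith

variable {S : ℝ → Hp →L[ℂ] Hp} {R : Hp →L[ℂ] HL} {Pm : HL →L[ℂ] HL}
variable {r : ℝ} {p : ℕ} {t : Fin (2 * 16 ^ p) → ℝ}

lemma norm_inner_BM_dyadic_le (hs : Setup S R Pm) (ht : t ∈ TM (16 ^ p)) {w : ℕ → ℝ → ℂ}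
    (hw : ∀ n, IsBlock (r * 4 ^ n) (w n)) (n m : ℕ) :
    ‖inner ℂ (hw n).toHp (BM S R Pm (16 ^ p) t (hw m).toHp)‖
      ≤ 100 * (decay p (Nat.dist n m) * (‖(hw n).toHp‖ * ‖(hw m).toHp‖)) := by
  have hr : 0 < r := by simpa using (hw 0).pos
  wlog hmn : m ≤ n generalizing n m
  · rw [← norm_inner_symm, ← ContinuousLinearMap.adjoint_inner_right,
      ContinuousLinearMap.isSelfAdjoint_iff'.1 (hs.isSelfAdjoint_BM (16 ^ p) t), Nat.dist_comm,
      mul_comm ‖(hw n).toHp‖]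
    exact this m n (by omega)
  obtain ⟨d, rfl⟩ := Nat.exists_eq_add_of_le hmn
  have h := norm_inner_BM_le_of_le hs (Nat.one_le_pow _ _ (by norm_num)) ht (hw (m + d)) (hw m)
    (by gcongr; norm_num)
  have e4 : (4 : ℝ) = 2 ^ 2 := by norm_num
  have e1 : √(r * 4 ^ (m + d) / (r * 4 ^ m)) = 2 ^ d := by
    rw [Real.sqrt_eq_iff_mul_self_eq (by positivity) (by positivity), pow_add]
    field_simp
    rw [e4, pow_right_comm]
  have e2 : √(r * 4 ^ m / (r * 4 ^ (m + d))) = (2 ^ d)⁻¹ := by rw [← e1, ← Real.sqrt_inv, inv_div]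
  have e3 : √((16 ^ p : ℕ) : ℝ) = 4 ^ p := by
    rw [Real.sqrt_eq_iff_mul_self_eq (by positivity) (by positivity), ← mul_pow]
    norm_num
  rw [e1, e2, e3, ← div_eq_mul_inv] at h
  rw [Nat.dist_comm, show Nat.dist m (m + d) = d by simp [Nat.dist], ← mul_assoc]
  exact h

lemma norm_inner_BM_sum_le (hs : Setup S R Pm) (ht : t ∈ TM (16 ^ p)) {w : ℕ → ℝ → ℂ}
    (hw : ∀ n, IsBlock (r * 4 ^ n) (w n)) (N : ℕ) :
    ‖inner ℂ (∑ n ∈ Finset.range N, (hw n).toHp)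
      (BM S R Pm (16 ^ p) t (∑ n ∈ Finset.range N, (hw n).toHp))‖
      ≤ 600 * 2 ^ p * ∑ n ∈ Finset.range N, normSq (w n) := by
  simp only [map_sum, sum_inner, inner_sum]
  calc _ ≤ ∑ n ∈ Finset.range N, ∑ m ∈ Finset.range N,
        100 * (decay p (Nat.dist n m) * (‖(hw n).toHp‖ * ‖(hw m).toHp‖)) := by
        refine (norm_sum_le _ _).trans (Finset.sum_le_sum fun n _ => (norm_sum_le _ _).trans
          (Finset.sum_le_sum fun m _ => ?_))
        simpa only [Nat.dist_comm, mul_comm ‖(hw n).toHp‖] using norm_inner_BM_dyadic_le hs ht hw m n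
    _ ≤ 100 * (6 * 2 ^ p * ∑ n ∈ Finset.range N, ‖(hw n).toHp‖ ^ 2) := by
        simp only [← Finset.mul_sum]
        gcongr
        exact sum_sum_decay_mul_le p N fun n => ‖(hw n).toHp‖
    _ = _ := by simp only [IsBlock.norm_toHp_sq]; ring

lemma sum_indicator_dyadic {E : Type*} [AddCommMonoid E] (hr : 0 < r) (f : ℝ → E) (N : ℕ) :
    ∑ n ∈ Finset.range N, (Set.Ico (r * 4 ^ n) (4 * (r * 4 ^ n))).indicator f
      = (Set.Ico r (r * 4 ^ N)).indicator f := by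
  induction N with
  | zero => ext; simp
  | succ N ih =>
    have hd : Disjoint (Set.Ico r (r * 4 ^ N)) (Set.Ico (r * 4 ^ N) (4 * (r * 4 ^ N))) :=
      Set.Ico_disjoint_Ico_same
    have h1 : r ≤ r * 4 ^ N := le_mul_of_one_le_right hr.le (one_le_pow₀ (by norm_num))
    have h2 : r * 4 ^ N ≤ 4 * (r * 4 ^ N) := by linarith
    rw [Finset.sum_range_succ, ih]
    refine (Set.indicator_union_of_disjoint hd f).symm.trans ?_
    rw [Set.Ico_union_Ico_eq_Ico h1 h2, pow_succ]
    congr 2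
    ring

lemma isBlock_indicator (φ : Hp) {a : ℝ} (ha : 0 < a) :
    IsBlock a ((Set.Ico a (4 * a)).indicator φ) := by
  have hm : Measurable φ := (Lp.stronglyMeasurable φ).measurable
  refine ⟨ha, hm.indicator measurableSet_Ico, fun k hk => Set.indicator_of_notMem hk _, ?_⟩
  have h : Integrable (fun k => ‖φ k‖ ^ 2) μp :=
    (memLp_two_iff_integrable_sq_norm (Lp.memLp φ).1).1 (Lp.memLp φ)
  have h' : IntegrableOn (fun k => ‖φ k‖ ^ 2) (Set.Ico a (4 * a)) :=
    IntegrableOn.mono_set h fun k hk => ha.trans_le hk.1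
  refine ((integrable_indicator_iff measurableSet_Ico).2 h').congr (.of_forall fun k => ?_)
  by_cases hk : k ∈ Set.Ico a (4 * a) <;> simp [hk]

/-- Truncations to `[4⁻ᴷ, 4ᴷ)` converge in `L²((0,∞))`. -/
lemma exists_tendsto_sum_blocks (φ : Hp) : ∃ v : ℕ → Hp, Tendsto v atTop (𝓝 φ) ∧
    ∀ K, ∃ (r : ℝ) (w : ℕ → ℝ → ℂ) (hw : ∀ n, IsBlock (r * 4 ^ n) (w n)) (N : ℕ),
      v K = ∑ n ∈ Finset.range N, (hw n).toHp ∧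
      ∑ n ∈ Finset.range N, normSq (w n) ≤ ‖φ‖ ^ 2 := by
  have hr : ∀ K : ℕ, 0 < ((4 : ℝ) ^ K)⁻¹ := fun K => by positivity
  have hw : ∀ K n : ℕ, IsBlock (((4 : ℝ) ^ K)⁻¹ * 4 ^ n)
    ((Set.Ico (((4 : ℝ) ^ K)⁻¹ * 4 ^ n) (4 * (((4 : ℝ) ^ K)⁻¹ * 4 ^ n))).indicator φ) := fun K n =>
      isBlock_indicator φ (by positivity)
  have hInt : Integrable (fun k => ‖φ k‖ ^ 2) μp :=
    (memLp_two_iff_integrable_sq_norm (Lp.memLp φ).1).1 (Lp.memLp φ)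
  refine ⟨fun K => ∑ n ∈ Finset.range (2 * K), (hw K n).toHp, ?_,
    fun K => ⟨_, _, hw K, 2 * K, rfl, ?_⟩⟩
  · have hv : ∀ K : ℕ, (∑ n ∈ Finset.range (2 * K), (hw K n).toHp : Hp) =ᵐ[μp]
        (Set.Ico ((4 : ℝ) ^ K)⁻¹ (((4 : ℝ) ^ K)⁻¹ * 4 ^ (2 * K))).indicator φ := fun K => by
      rw [← sum_indicator_dyadic (hr K)]
      refine (Lp.coeFn_finsetSum _ _).trans ?_
      have : ∀ᵐ k ∂μp, ∀ n ∈ Finset.range (2 * K), (hw K n).toHp k = _ :=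
        (Finset.eventually_all _).2 fun n _ => (hw K n).coeFn_toHp
      filter_upwards [this] with k hk
      simp only [Finset.sum_apply]
      exact Finset.sum_congr rfl hk
    have hsq : ∀ K : ℕ, ‖(∑ n ∈ Finset.range (2 * K), (hw K n).toHp) - φ‖ ^ 2
        = ∫ k, ‖(Set.Ico ((4 : ℝ) ^ K)⁻¹ (((4 : ℝ) ^ K)⁻¹ * 4 ^ (2 * K))).indicator φ k - φ k‖ ^ 2
          ∂μp := fun K => by
      rw [norm_sq_eq_integral]
      refine integral_congr_ae ?_
      filter_upwards [Lp.coeFn_sub (∑ n ∈ Finset.range (2 * K), (hw K n).toHp) φ, hv K] with k h1 h2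
      rw [h1, Pi.sub_apply, h2]
    have hlim : Tendsto (fun K : ℕ => ‖(∑ n ∈ Finset.range (2 * K), (hw K n).toHp) - φ‖ ^ 2) atTop
        (𝓝 (∫ _, (0 : ℝ) ∂μp)) := by
      simp only [hsq]
      refine tendsto_integral_of_dominated_convergence _ (fun K => ?_) hInt (fun K => ?_) ?_
      · exact ((((Lp.stronglyMeasurable φ).indicator measurableSet_Ico).sub
          (Lp.stronglyMeasurable φ)).norm.pow 2).aestronglyMeasurable
      · refine .of_forall fun k => ?_
        rw [Real.norm_of_nonneg (by positivity)]
        gcongr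
        by_cases hk : k ∈ Set.Ico ((4 : ℝ) ^ K)⁻¹ (((4 : ℝ) ^ K)⁻¹ * 4 ^ (2 * K)) <;> simp [hk]
      · filter_upwards [ae_restrict_mem measurableSet_Ioi] with k hk
        have hk' : 0 < k := hk
        have hpow := tendsto_pow_atTop_atTop_of_one_lt (r := (4 : ℝ)) (by norm_num)
        refine tendsto_const_nhds.congr' ?_
        filter_upwards [hpow.eventually_ge_atTop k⁻¹, hpow.eventually_gt_atTop k] with K h1 h2
        have hmem : k ∈ Set.Ico ((4 : ℝ) ^ K)⁻¹ (((4 : ℝ) ^ K)⁻¹ * 4 ^ (2 * K)) := by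
          refine ⟨inv_le_of_inv_le₀ hk' h1, ?_⟩
          rwa [two_mul, pow_add, inv_mul_cancel_left₀ (by positivity)]
        simp [hmem]
    rw [integral_zero] at hlim
    rw [tendsto_iff_norm_sub_tendsto_zero]
    simpa using hlim.sqrt
  · have hn : ∀ n, normSq ((Set.Ico (((4 : ℝ) ^ K)⁻¹ * 4 ^ n)
        (4 * (((4 : ℝ) ^ K)⁻¹ * 4 ^ n))).indicator φ) = ∫ k in Set.Ioi 0,
        (Set.Ico (((4 : ℝ) ^ K)⁻¹ * 4 ^ n) (4 * (((4 : ℝ) ^ K)⁻¹ * 4 ^ n))).indicator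
          (fun k => ‖φ k‖ ^ 2) k := fun n => by
      rw [normSq, ← (hw K n).setIntegral_Ioi fun k hk => by simp [hk]]
      refine integral_congr_ae (.of_forall fun k => ?_)
      simp only [Set.indicator_apply]
      split_ifs <;> simp
    simp only [hn]
    rw [← integral_finsetSum _ fun n _ => hInt.indicator measurableSet_Ico, norm_sq_eq_integral]
    refine integral_mono_of_nonneg (.of_forall fun k => ?_) hInt (.of_forall fun k => ?_)
    · exact Finset.sum_nonneg fun n _ => Set.indicator_nonneg (fun _ _ => by positivity) _
    · have := congrFun (sum_indicator_dyadic (hr K) (fun k => ‖φ k‖ ^ 2) (2 * K)) k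
      rw [Finset.sum_apply] at this
      simp only [this]
      exact Set.indicator_le_self' (fun _ _ => by positivity) k

lemma norm_inner_BM_pow_le (hs : Setup S R Pm) (ht : t ∈ TM (16 ^ p)) (φ : Hp) :
    ‖inner ℂ φ (BM S R Pm (16 ^ p) t φ)‖ ≤ 600 * 2 ^ p * ‖φ‖ ^ 2 := by
  obtain ⟨v, hv, h⟩ := exists_tendsto_sum_blocks φ
  refine le_of_tendsto (hv.inner (((BM S R Pm (16 ^ p) t).continuous.tendsto φ).comp hv)).norm
    (.of_forall fun K => ?_)
  obtain ⟨r, w, hw, N, hvK, hN⟩ := h K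
  rw [Function.comp_apply, hvK]
  refine (norm_inner_BM_sum_le hs ht hw N).trans ?_
  gcongr

end

section
open ComplexConjugate Topology

/-- The endpoints of the intervals `[j/(2M), j/(2M) + 1/(24M)]`. -/
def combTimes (M : ℕ) (i : Fin (2 * M)) : ℝ := ((12 * (i.1 / 2) + i.1 % 2 : ℕ) : ℝ) / (24 * M)

lemma combTimes_mem_TM {M : ℕ} (hM : 1 ≤ M) : combTimes M ∈ TM M := by
  intro i j hij
  have hM' : (0 : ℝ) < M := by exact_mod_cast hM
  have h : i.1 < j.1 := hij
  unfold combTimes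
  refine div_lt_div_of_pos_right (Nat.cast_lt.2 ?_) (by positivity)
  omega

lemma isBlock_one {a c : ℝ} (ha : 0 < a) (hc : c ≤ 4 * a) :
    IsBlock a ((Set.Ico a c).indicator (1 : ℝ → ℂ)) := by
  refine ⟨ha, measurable_one.indicator measurableSet_Ico, fun k hk =>
    Set.indicator_of_notMem (fun h => hk ⟨h.1, h.2.trans_le hc⟩) _, ?_⟩
  refine ((integrable_indicator_iff (f := (1 : ℝ → ℝ)) (s := Set.Ico a c) measurableSet_Ico).2
    (integrableOn_const (by simp))).congr (.of_forall fun k => ?_)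
  by_cases hk : k ∈ Set.Ico a c <;> simp [hk]

lemma normSq_one {a c : ℝ} (hac : a ≤ c) :
    normSq ((Set.Ico a c).indicator (1 : ℝ → ℂ)) = c - a := by
  rw [normSq, ← Real.volume_real_Ico_of_le hac, ← integral_indicator_one measurableSet_Ico]
  refine integral_congr_ae (.of_forall fun k => ?_)
  by_cases hk : k ∈ Set.Ico a c <;> simp [hk]

lemma half_le_cos_add {θ : ℝ} (h : |θ| ≤ Real.pi / 3) (j : ℕ) :
    1 / 2 ≤ Real.cos (θ + j * (2 * Real.pi)) := by
  rw [Real.cos_add_nat_mul_two_pi, ← Real.cos_abs, ← Real.cos_pi_div_three]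
  exact Real.cos_le_cos_of_nonneg_of_le_pi (abs_nonneg _) (by linarith [Real.pi_pos]) h

/-- During the comb intervals the relative phase of the two momenta is close to `2πℤ`. -/
lemma half_le_cos_phase {M j : ℕ} (hj : j < M) {a k l s : ℝ} (ha : 0 < a)
    (ha2 : a ^ 2 = 4 * Real.pi * M) (hk : k ∈ Set.Ico a (a + 1 / (3 * a)))
    (hl : l ∈ Set.Ico (1 / 4 : ℝ) 1)
    (hs : s ∈ Set.Icc ((12 * j : ℝ) / (24 * M)) ((12 * j + 1) / (24 * M))) :
    1 / 2 ≤ Real.cos ((k ^ 2 - l ^ 2) * s) := by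
  have hπ := Real.pi_gt_d2
  have hM : (1 : ℝ) ≤ M := by exact_mod_cast (by omega : 1 ≤ M)
  have hM0 : (0 : ℝ) < M := by linarith
  have hjM : (j : ℝ) + 1 ≤ M := by exact_mod_cast hj
  obtain ⟨s1, s2⟩ := hs
  rw [div_le_iff₀ (by positivity)] at s1
  rw [le_div_iff₀ (by positivity)] at s2
  have hs0 : 0 ≤ s := by
    by_contra h
    have : s * (24 * M) < 0 := mul_neg_of_neg_of_pos (not_le.1 h) (by positivity)
    have : (0 : ℝ) ≤ j := by positivity
    linarith
  have hs1 : s ≤ 1 / 2 := by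
    by_contra h
    have : 1 / 2 * (24 * M) < s * (24 * M) := mul_lt_mul_of_pos_right (not_le.1 h) (by positivity)
    linarith
  have ha12 : 12 ≤ a ^ 2 := by rw [ha2]; nlinarith
  have hk1 : a ^ 2 ≤ k ^ 2 := by have := hk.1; gcongr
  have hk2 : k ^ 2 ≤ a ^ 2 + 1 := by
    have h1 : k ^ 2 ≤ (a + 1 / (3 * a)) ^ 2 := by
      have := hk.2; have := ha.le.trans hk.1; gcongr
    have h2 : (a + 1 / (3 * a)) ^ 2 = a ^ 2 + 2 / 3 + 1 / (9 * a ^ 2) := by field_simp; ring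
    have h3 : 1 / (9 * a ^ 2) ≤ 1 / 3 := by
      rw [div_le_div_iff₀ (by positivity) (by norm_num)]
      linarith
    linarith
  have hl1 : 0 ≤ l ^ 2 := sq_nonneg l
  have hl2 : l ^ 2 ≤ 1 := by nlinarith [hl.1, hl.2]
  have he : |k ^ 2 - l ^ 2 - a ^ 2| ≤ 1 := by rw [abs_le]; constructor <;> linarith
  have hes : |(k ^ 2 - l ^ 2 - a ^ 2) * s| ≤ 1 / 2 := by
    rw [abs_mul, abs_of_nonneg hs0]
    nlinarith [abs_nonneg (k ^ 2 - l ^ 2 - a ^ 2)]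
  have hes' := abs_le.1 hes
  have h := half_le_cos_add (θ := (k ^ 2 - l ^ 2 - a ^ 2) * s + (a ^ 2 * s - j * (2 * Real.pi))) ?_ j
  · convert h using 2
    ring
  · have h1 : 0 ≤ a ^ 2 * s - j * (2 * Real.pi) := by
      rw [ha2]; nlinarith [Real.pi_pos]
    have h2 : a ^ 2 * s - j * (2 * Real.pi) ≤ Real.pi / 6 := by
      rw [ha2]; nlinarith [Real.pi_pos]
    rw [abs_le]
    constructor <;> linarith

lemma integral_indicator_one_complex {a c : ℝ} (hac : a ≤ c) :
    ∫ k, (Set.Ico a c).indicator (1 : ℝ → ℝ) k = c - a := by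
  rw [integral_indicator_one measurableSet_Ico, Real.volume_real_Ico_of_le hac]

lemma le_re_current {a c b d s : ℝ} (ha : 0 < a) (hb : 0 < b) (hac : a ≤ c) (hbd : b ≤ d)
    (hc : c ≤ 4 * a) (hd : d ≤ 4 * b)
    (hcos : ∀ k ∈ Set.Ico a c, ∀ l ∈ Set.Ico b d, 1 / 2 ≤ Real.cos ((k ^ 2 - l ^ 2) * s)) :
    a / 2 * ((c - a) * (d - b)) ≤
      (current ((Set.Ico a c).indicator 1) ((Set.Ico b d).indicator 1) s).re := by
  have hφ := isBlock_one ha hc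
  have hψ := isBlock_one hb hd
  have hi := (hφ.integrable_prod_momentum hψ).mul_bdd (c := 1) (g := fun p : ℝ × ℝ =>
    Complex.exp (Complex.I * ((p.1 : ℂ) ^ 2 - (p.2 : ℂ) ^ 2) * (s : ℂ)))
    (by fun_prop) (.of_forall fun p => (norm_exp_phase_sub _ _ _).le)
  rw [hφ.current_eq hψ, ← integral_indicator_one_complex hac, ← integral_indicator_one_complex hbd,
    ← integral_prod_mul, ← integral_const_mul, Measure.volume_eq_prod ℝ ℝ, ← RCLike.re_eq_complex_re, ← integral_re hi]
  refine integral_mono_of_nonneg (.of_forall fun p => ?_) hi.re (.of_forall fun p => ?_)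
  · exact mul_nonneg (by positivity) (mul_nonneg (Set.indicator_nonneg (by simp) _)
      (Set.indicator_nonneg (by simp) _))
  · by_cases h1 : p.1 ∈ Set.Ico a c
    · by_cases h2 : p.2 ∈ Set.Ico b d
      · have e : Complex.I * ((p.1 : ℂ) ^ 2 - (p.2 : ℂ) ^ 2) * (s : ℂ)
            = (((p.1 ^ 2 - p.2 ^ 2) * s : ℝ) : ℂ) * Complex.I := by push_cast; ring
        have h3 := hcos _ h1 _ h2
        have h4 := h1.1
        have h5 := hb.le.trans h2.1
        simp only [h1, h2, Set.indicator_of_mem, Pi.one_apply, map_one, one_mul, mul_one,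
          RCLike.re_eq_complex_re, e]
        rw [← Complex.ofReal_add, Complex.re_ofReal_mul, Complex.exp_ofReal_mul_I_re]
        nlinarith
      · simp [h2]
    · simp [h1]

variable {S : ℝ → Hp →L[ℂ] Hp} {R : Hp →L[ℂ] HL} {Pm : HL →L[ℂ] HL}

lemma add_inv_le_four_mul {M : ℕ} (hM : 1 ≤ M) {a : ℝ} (ha : 0 < a)
    (ha2 : a ^ 2 = 4 * Real.pi * M) : a + 1 / (3 * a) ≤ 4 * a := by
  have hM0 : (1 : ℝ) ≤ M := by exact_mod_cast hM
  have hπ := Real.pi_gt_d2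
  have : 1 / (3 * a) ≤ 3 * a := by
    rw [div_le_iff₀ (by positivity)]
    nlinarith
  linarith

lemma re_inner_BM_comb_le (hs : Setup S R Pm) {M : ℕ} (hM : 1 ≤ M) {a : ℝ} (ha : 0 < a)
    (ha2 : a ^ 2 = 4 * Real.pi * M) (hφ : IsBlock a ((Set.Ico a (a + 1 / (3 * a))).indicator 1))
    (hψ : IsBlock (1 / 4) ((Set.Ico (1 / 4) 1).indicator 1)) :
    (inner ℂ hφ.toHp (BM S R Pm M (combTimes M) hψ.toHp)).re ≤ -(1 / (384 * Real.pi)) := by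
  have hM0 : (0 : ℝ) < M := by exact_mod_cast hM
  have hc := hφ.continuous_current hψ
  have hca := add_inv_le_four_mul hM ha ha2
  rw [inner_BM_eq_sum hs (combTimes_mem_TM hM), ← Complex.ofReal_inv, ← Complex.ofReal_neg,
    Complex.re_ofReal_mul, Complex.re_sum]
  have key : ∀ j : Fin M, 1 / (192 * M : ℝ) ≤
      (∫ s in (combTimes M ⟨2 * j.1, by have := j.isLt; omega⟩)..
        (combTimes M ⟨2 * j.1 + 1, by have := j.isLt; omega⟩),
        current ((Set.Ico a (a + 1 / (3 * a))).indicator 1)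
          ((Set.Ico (1 / 4) 1).indicator 1) s).re := fun j => by
    have e1 : combTimes M ⟨2 * j.1, by have := j.isLt; omega⟩ = (12 * j.1 : ℝ) / (24 * M) := by
      simp [combTimes]
    have e2 : combTimes M ⟨2 * j.1 + 1, by have := j.isLt; omega⟩
        = (12 * j.1 + 1 : ℝ) / (24 * M) := by
      have h1 : (2 * j.1 + 1) / 2 = j.1 := by omega
      have h2 : (2 * j.1 + 1) % 2 = 1 := by omega
      simp [combTimes, h1, h2]
    rw [e1, e2]
    have hle : (12 * j.1 : ℝ) / (24 * M) ≤ (12 * j.1 + 1 : ℝ) / (24 * M) := by gcongr; linarith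
    rw [← RCLike.re_eq_complex_re, ← RCLike.reCLM_apply,
      ← ContinuousLinearMap.intervalIntegral_comp_comm _ (hc.intervalIntegrable _ _)]
    have h := intervalIntegral.integral_mono_on (μ := volume) (f := fun _ => (1 / 8 : ℝ)) hle
      intervalIntegrable_const ((RCLike.reCLM.continuous.comp hc).intervalIntegrable _ _) fun s hs => by
        have h1 := le_re_current (s := s) ha (by norm_num : (0 : ℝ) < 1 / 4)
          (by simp [ha.le] : a ≤ a + 1 / (3 * a)) (by norm_num : (1 / 4 : ℝ) ≤ 1)
          hca (by norm_num) fun k hk l hl => half_le_cos_phase j.isLt ha ha2 hk hl hs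
        refine le_trans (le_of_eq ?_) h1
        field_simp
        norm_num
    refine le_trans (le_of_eq ?_) h
    rw [intervalIntegral.integral_const, smul_eq_mul]
    field_simp
    ring
  have hsum := Finset.sum_le_sum fun j (_ : j ∈ Finset.univ) => key j
  rw [Finset.sum_const, Finset.card_univ, Fintype.card_fin, nsmul_eq_mul] at hsum
  have hπ := Real.pi_pos
  calc _ ≤ -(2 * Real.pi)⁻¹ * (M * (1 / (192 * M : ℝ))) :=
        mul_le_mul_of_nonpos_left hsum (by simp [hπ.le])
    _ = _ := by field_simp; norm_num

end

section
open ComplexConjugate Topology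

lemma re_inner_add_self {B : Hp →L[ℂ] Hp} (hB : IsSelfAdjoint B) (u v : Hp) :
    (inner ℂ (u + v) (B (u + v))).re
      = (inner ℂ u (B u)).re + (inner ℂ v (B v)).re + 2 * (inner ℂ u (B v)).re := by
  have h : (inner ℂ v (B u)).re = (inner ℂ u (B v)).re := by
    rw [← ContinuousLinearMap.adjoint_inner_left, ContinuousLinearMap.isSelfAdjoint_iff'.1 hB,
      ← inner_conj_symm, Complex.conj_re]
  simp only [map_add, inner_add_left, inner_add_right, Complex.add_re, h]
  ring

/-- A strongly negative off-diagonal entry makes the top of the spectrum large. -/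
lemma div_three_le_sSup_spectrum {B : Hp →L[ℂ] Hp} (hB : IsSelfAdjoint B) {u v : Hp} {c : ℝ}
    (hc : 75 < c) (huv : ‖u‖ ^ 2 + ‖v‖ ^ 2 ≤ 3 / 2) (hu : -(100 * ‖u‖ ^ 2) ≤ (inner ℂ u (B u)).re)
    (hv : -(100 * ‖v‖ ^ 2) ≤ (inner ℂ v (B v)).re) (h : c ≤ (inner ℂ u (B v)).re) :
    (2 * c - 150) / 3 ≤ sSup (spectrum ℝ B) := by
  have h1 := re_inner_le_sSup_spectrum hB (u + v)
  rw [re_inner_add_self hB] at h1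
  have h2 : ‖u + v‖ ^ 2 ≤ 3 := by
    have h3 : ‖u + v‖ ^ 2 ≤ (‖u‖ + ‖v‖) ^ 2 := by gcongr; exact norm_add_le _ _
    nlinarith [sq_nonneg (‖u‖ - ‖v‖)]
  have h4 : 2 * c - 150 ≤ sSup (spectrum ℝ B) * ‖u + v‖ ^ 2 := by
    refine le_trans ?_ h1
    linarith
  have h5 : 0 < sSup (spectrum ℝ B) := by
    by_contra h6
    nlinarith [mul_nonpos_of_nonpos_of_nonneg (not_lt.1 h6) (sq_nonneg ‖u + v‖)]
  have h7 : sSup (spectrum ℝ B) * ‖u + v‖ ^ 2 ≤ sSup (spectrum ℝ B) * 3 := by gcongr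
  linarith

variable {S : ℝ → Hp →L[ℂ] Hp} {R : Hp →L[ℂ] HL} {Pm : HL →L[ℂ] HL}

lemma norm_inner_BM_block_le (hs : Setup S R Pm) {M : ℕ} (hM : 1 ≤ M) {t : Fin (2 * M) → ℝ}
    (ht : t ∈ TM M) {a : ℝ} {φ : ℝ → ℂ} (hφ : IsBlock a φ) :
    ‖inner ℂ hφ.toHp (BM S R Pm M t hφ.toHp)‖ ≤ 100 * ‖hφ.toHp‖ ^ 2 := by
  have h := norm_inner_BM_le_of_le hs hM ht hφ hφ le_rfl
  have hM' : 1 ≤ √(M : ℝ) := Real.one_le_sqrt.2 (by exact_mod_cast hM)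
  rwa [div_self hφ.pos.ne', Real.sqrt_one, mul_one, min_eq_left hM', mul_one, ← sq] at h

/-- Two test vectors that are strongly coupled by the comb of `M` intervals. -/
lemma exists_test_vectors (hs : Setup S R Pm) {M : ℕ} (hM : 1 ≤ M) :
    ∃ u v : Hp, ‖u‖ ^ 2 + ‖v‖ ^ 2 ≤ 3 / 2 ∧
      ‖inner ℂ u (BM S R Pm M (combTimes M) u)‖ ≤ 100 * ‖u‖ ^ 2 ∧
      ‖inner ℂ v (BM S R Pm M (combTimes M) v)‖ ≤ 100 * ‖v‖ ^ 2 ∧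
      (inner ℂ u (BM S R Pm M (combTimes M) v)).re ≤ -((M : ℝ) ^ (1 / 4 : ℝ) / 1300) := by
  have hM0 : (1 : ℝ) ≤ M := by exact_mod_cast hM
  set a : ℝ := √(4 * Real.pi * M) with ha
  have ha0 : 0 < a := by positivity
  have ha2 : a ^ 2 = 4 * Real.pi * M := Real.sq_sqrt (by positivity)
  have hφ := isBlock_one ha0 (add_inv_le_four_mul hM ha0 ha2)
  have hψ := isBlock_one (a := 1 / 4) (c := 1) (by norm_num) (by norm_num)
  have hnφ : ‖hφ.toHp‖ ^ 2 = 1 / (3 * a) := by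
    rw [hφ.norm_toHp_sq, normSq_one (by simp [ha0.le])]
    ring
  have hnψ : ‖hψ.toHp‖ ^ 2 = 3 / 4 := by
    rw [hψ.norm_toHp_sq, normSq_one (by norm_num)]
    norm_num
  have ht := combTimes_mem_TM hM
  have hra : ‖((√a : ℝ) : ℂ)‖ = √a := by rw [Complex.norm_real, Real.norm_of_nonneg (by positivity)]
  refine ⟨((√a : ℝ) : ℂ) • hφ.toHp, hψ.toHp, ?_, ?_, norm_inner_BM_block_le hs hM ht hψ, ?_⟩
  · rw [norm_smul, mul_pow, hra, Real.sq_sqrt ha0.le, hnφ, hnψ]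
    have : a * (1 / (3 * a)) = 1 / 3 := by field_simp
    rw [this]
    norm_num
  · rw [map_smul, inner_smul_left, inner_smul_right, norm_mul, norm_mul, RCLike.norm_conj,
      norm_smul, mul_pow]
    have := norm_inner_BM_block_le hs hM ht hφ
    calc _ = ‖((√a : ℝ) : ℂ)‖ ^ 2 * ‖inner ℂ hφ.toHp (BM S R Pm M (combTimes M) hφ.toHp)‖ := by ring
      _ ≤ ‖((√a : ℝ) : ℂ)‖ ^ 2 * (100 * ‖hφ.toHp‖ ^ 2) := by gcongr
      _ = _ := by ring
  · have h := re_inner_BM_comb_le hs hM ha0 ha2 hφ hψ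
    rw [inner_smul_left, Complex.conj_ofReal, Complex.re_ofReal_mul]
    have h1 : (M : ℝ) ^ (1 / 4 : ℝ) ≤ √a := by
      rw [show (1 / 4 : ℝ) = 1 / 2 * (1 / 2) by norm_num, Real.rpow_mul (by positivity),
        ← Real.sqrt_eq_rpow, ← Real.sqrt_eq_rpow, ha]
      gcongr
      nlinarith [Real.pi_gt_d2]
    have h2 : (1 : ℝ) / 1300 ≤ 1 / (384 * Real.pi) := by
      gcongr
      linarith [Real.pi_lt_d2]
    calc _ ≤ √a * -(1 / (384 * Real.pi)) := by gcongr
      _ = -(√a * (1 / (384 * Real.pi))) := by ring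
      _ ≤ -((M : ℝ) ^ (1 / 4 : ℝ) * (1 / 1300)) := by gcongr
      _ = _ := by ring

lemma tendsto_natCast_rpow_quarter :
    Tendsto (fun M : ℕ => (M : ℝ) ^ (1 / 4 : ℝ)) atTop atTop :=
  (tendsto_rpow_atTop (by norm_num)).comp tendsto_natCast_atTop_atTop

lemma eventually_le_sSup_spectrum_comb (hs : Setup S R Pm) : ∀ᶠ M : ℕ in atTop,
    (M : ℝ) ^ (1 / 4 : ℝ) / 4000 ≤ sSup (spectrum ℝ (BM S R Pm M (combTimes M))) ∧
    (M : ℝ) ^ (1 / 4 : ℝ) / 4000 ≤ sSup (spectrum ℝ (-BM S R Pm M (combTimes M))) := by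
  filter_upwards [tendsto_natCast_rpow_quarter.eventually_ge_atTop 1000000, eventually_ge_atTop 1]
    with M hM4 hM
  obtain ⟨u, v, h1, h2, h3, h4⟩ := exists_test_vectors hs hM
  have hB := hs.isSelfAdjoint_BM M (combTimes M)
  have h2' := abs_le.1 ((Complex.abs_re_le_norm _).trans h2)
  have h3' := abs_le.1 ((Complex.abs_re_le_norm _).trans h3)
  set c := (M : ℝ) ^ (1 / 4 : ℝ)
  constructor
  · refine le_trans ?_ (div_three_le_sSup_spectrum hB (u := -u) (v := v) (c := c / 1300)
      (by linarith) (by simpa using h1) (by simpa using h2'.1) h3'.1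
      (by rw [inner_neg_left, Complex.neg_re]; linarith))
    linarith
  · refine le_trans ?_ (div_three_le_sSup_spectrum hB.neg (u := u) (v := v) (c := c / 1300)
      (by linarith) h1 (by simpa using h2'.2) (by simpa using h3'.2)
      (by rw [neg_apply, inner_neg_right, Complex.neg_re]; linarith))
    linarith

lemma sSup_spectrum_BM_le (hs : Setup S R Pm) {M : ℕ} {t : Fin (2 * M) → ℝ} {C : ℝ}
    (h : ∀ φ, ‖inner ℂ φ (BM S R Pm M t φ)‖ ≤ C * ‖φ‖ ^ 2) :
    sSup (spectrum ℝ (BM S R Pm M t)) ≤ C ∧ sSup (spectrum ℝ (-BM S R Pm M t)) ≤ C := by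
  have hB := hs.isSelfAdjoint_BM M t
  refine ⟨sSup_spectrum_le hB fun φ => (Complex.re_le_norm _).trans (h φ),
    sSup_spectrum_le hB.neg fun φ => (Complex.re_le_norm _).trans ?_⟩
  rw [neg_apply, inner_neg_right, norm_neg]
  exact h φ

lemma sSup_spectrum_le_cback (hs : Setup S R Pm) {M : ℕ} {t : Fin (2 * M) → ℝ} (ht : t ∈ TM M) :
    sSup (spectrum ℝ (BM S R Pm M t)) ≤ cback S R Pm M := by
  refine le_csSup ⟨2 * M, ?_⟩ (Set.mem_image_of_mem _ ht)
  rintro _ ⟨t, -, rfl⟩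
  exact (sSup_spectrum_BM_le hs (hs.norm_inner_BM_le M t)).1

lemma cover_le_neg_sSup_spectrum (hs : Setup S R Pm) {M : ℕ} {t : Fin (2 * M) → ℝ}
    (ht : t ∈ TM M) : cover S R Pm M ≤ -sSup (spectrum ℝ (-BM S R Pm M t)) := by
  refine (csInf_le ⟨-(2 * M : ℝ), ?_⟩ (Set.mem_image_of_mem _ ht)).trans (sInf_spectrum_eq _).le
  rintro _ ⟨t, -, rfl⟩
  exact (neg_le_neg (sSup_spectrum_BM_le hs (hs.norm_inner_BM_le M t)).2).trans
    (sInf_spectrum_eq _).ge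

lemma cback_pow_le (hs : Setup S R Pm) (p : ℕ) : cback S R Pm (16 ^ p) ≤ 600 * 2 ^ p := by
  refine csSup_le (Set.Nonempty.image _ ⟨_, combTimes_mem_TM (Nat.one_le_pow _ _ (by norm_num))⟩) ?_
  rintro _ ⟨t, ht, rfl⟩
  exact (sSup_spectrum_BM_le hs (norm_inner_BM_pow_le hs ht)).1

lemma neg_le_cover_pow (hs : Setup S R Pm) (p : ℕ) : -(600 * 2 ^ p) ≤ cover S R Pm (16 ^ p) := by
  refine le_csInf (Set.Nonempty.image _ ⟨_, combTimes_mem_TM (Nat.one_le_pow _ _ (by norm_num))⟩) ?_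
  rintro _ ⟨t, ht, rfl⟩
  exact (neg_le_neg (sSup_spectrum_BM_le hs (norm_inner_BM_pow_le hs ht)).2).trans
    (sInf_spectrum_eq _).ge

lemma sixteen_pow_rpow (p : ℕ) : ((16 ^ p : ℕ) : ℝ) ^ (-(1 : ℝ) / 4) = (2 ^ p)⁻¹ := by
  rw [show ((16 ^ p : ℕ) : ℝ) = (2 ^ p) ^ (4 : ℝ) by
    rw [show (4 : ℝ) = (4 : ℕ) by norm_num, Real.rpow_natCast, ← pow_mul, mul_comm, pow_mul]
    norm_num, ← Real.rpow_mul (by positivity)]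
  norm_num
  rw [Real.rpow_neg_one]

end

/-- `liminf M^{-1/4} c_back^{(M)} > 0` and `limsup M^{-1/4} c_over^{(M)} < 0`;
in particular `c_back^{(M)} → +∞` and `c_over^{(M)} → −∞` as `M → ∞`. -/
theorem backflow_overflow_constants_unbounded
    (S : ℝ → Hp →L[ℂ] Hp) (R : Hp →L[ℂ] HL) (Pm : HL →L[ℂ] HL)
    (hSetup : Setup S R Pm) :
    0 < liminf (fun M : ℕ => (M:ℝ) ^ (-(1:ℝ)/4) * cback S R Pm M) atTop ∧
    limsup (fun M : ℕ => (M:ℝ) ^ (-(1:ℝ)/4) * cover S R Pm M) atTop < 0 ∧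
    Tendsto (fun M : ℕ => cback S R Pm M) atTop atTop ∧
    Tendsto (fun M : ℕ => cover S R Pm M) atTop atBot := by
  have hgrow := tendsto_natCast_rpow_quarter.atTop_div_const (show (0 : ℝ) < 4000 by norm_num)
  have hlow : ∀ᶠ M : ℕ in atTop, (M : ℝ) ^ (1 / 4 : ℝ) / 4000 ≤ cback S R Pm M ∧
      cover S R Pm M ≤ -((M : ℝ) ^ (1 / 4 : ℝ) / 4000) := by
    filter_upwards [eventually_le_sSup_spectrum_comb hSetup, eventually_ge_atTop 1] with M h hM
    have ht := combTimes_mem_TM hM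
    exact ⟨h.1.trans (sSup_spectrum_le_cback hSetup ht),
      (cover_le_neg_sSup_spectrum hSetup ht).trans (neg_le_neg h.2)⟩
  have hscale : ∀ M : ℕ, 1 ≤ M →
      (M : ℝ) ^ (-(1 : ℝ) / 4) * ((M : ℝ) ^ (1 / 4 : ℝ) / 4000) = 1 / 4000 := fun M hM => by
    have hM0 : (0 : ℝ) < M := by exact_mod_cast hM
    rw [← mul_div_assoc, ← Real.rpow_add hM0]
    norm_num
  have hfreq : ∀ {P : ℕ → Prop}, (∀ p, P (16 ^ p)) → ∃ᶠ M in atTop, P M := fun hP =>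
    frequently_atTop.2 fun N => ⟨16 ^ N, (Nat.lt_pow_self (by norm_num)).le, hP N⟩
  refine ⟨?_, ?_, tendsto_atTop_mono' _ (hlow.mono fun _ h => h.1) hgrow,
    tendsto_atBot_mono' _ (hlow.mono fun _ h => h.2) (tendsto_neg_atTop_atBot.comp hgrow)⟩
  · refine lt_of_lt_of_le (by norm_num : (0 : ℝ) < 1 / 4000) (le_liminf_of_le
      (IsCoboundedUnder.of_frequently_le (a := 600) (hfreq fun p => ?_)) ?_)
    · rw [sixteen_pow_rpow]
      calc _ ≤ ((2 : ℝ) ^ p)⁻¹ * (600 * 2 ^ p) := by gcongr; exact cback_pow_le hSetup p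
        _ = 600 := by field_simp
    · filter_upwards [hlow, eventually_ge_atTop 1] with M h hM
      rw [← hscale M hM]
      gcongr
      exact h.1
  · refine lt_of_le_of_lt (limsup_le_of_le
      (IsCoboundedUnder.of_frequently_ge (a := -600) (hfreq fun p => ?_)) ?_)
      (by norm_num : -(1 / 4000) < (0 : ℝ))
    · rw [sixteen_pow_rpow]
      calc (-600 : ℝ) = ((2 : ℝ) ^ p)⁻¹ * -(600 * 2 ^ p) := by field_simp
        _ ≤ _ := by gcongr; exact neg_le_cover_pow hSetup p
    · filter_upwards [hlow, eventually_ge_atTop 1] with M h hM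
      rw [← hscale M hM, ← mul_neg]
      gcongr
      exact h.2

end QB
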